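/- arXiv:1711.04544 — 3 statements merged into one kernel-verified Lean document; each statement's English description precedes it below -/
import Mathlib

section
/- Let Z ⊆ ℝ^n be a real algebraic variety of codimension m (i.e., Z is the common zero set of a family of real polynomials, each of degree at most d, and Z has Hausdorff dimension n − m). Then there exists a positive constant C depending only on n such that for all r > 0 and all δ > 0, vol_n(Z_δ ∩ Δ_r^n) ≤ C((dδ)^m r^{n−m} + (dδ)^n). -/
open MeasureTheory Metric MvPolynomial
open scoped ENNReal NNReal

/-- The open cube `Δ_r^n = (-r, r)^n` in `ℝ^n`. -/
def cube (n : ℕ) (r : ℝ) : Set (EuclideanSpace ℝ (Fin n)) :=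
  {x | ∀ i, x i ∈ Set.Ioo (-r) r}

lemma elim_poly {σ : Type} [Fintype σ] [DecidableEq σ] (D : ℕ) (p : σ → MvPolynomial σ ℝ)
    (hp : ∀ i, (p i).totalDegree ≤ D) (h : MvPolynomial σ ℝ) (hh : h.totalDegree ≤ 1) :
    ∃ R : MvPolynomial σ ℝ, R ≠ 0 ∧ ∀ y : σ → ℝ, eval y R ≠ 0 → ∃ q : Polynomial ℝ, q ≠ 0 ∧
      q.natDegree ≤ (1 + Fintype.card σ * D) ^ Fintype.card σ ∧
      ∀ x : σ → ℝ, (∀ i, eval x (p i) = y i) → q.eval (eval x h) = 0 := by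
  set k := Fintype.card σ with hk
  set A := (1 + k * D) ^ k with hA
  set T := A + k * (A * D) with hT
  let I := Fin (A + 1) × (σ → Fin (A + 1))
  let E := σ → Fin (T + 1)
  let G : I → MvPolynomial σ ℝ := fun ab => h ^ (ab.1 : ℕ) * ∏ i, p i ^ (ab.2 i : ℕ)
  let toE : E → (σ →₀ ℕ) := fun e => Finsupp.equivFunOnFinite.symm (fun i => (e i : ℕ))
  let Φ : (I → ℝ) →ₗ[ℝ] (E → ℝ) :=
    { toFun := fun c e => coeff (toE e) (∑ ab, c ab • G ab)
      map_add' := by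
        intro c c'; ext e
        simp [add_smul, Finset.sum_add_distrib]
      map_smul' := by
        intro r c; ext e
        simp [mul_assoc, Finset.mul_sum, coeff_sum] }
  have hlt : Module.finrank ℝ (E → ℝ) < Module.finrank ℝ (I → ℝ) := by
    simp only [Module.finrank_fintype_fun_eq_card, E, I, Fintype.card_prod, Fintype.card_fun,
      Fintype.card_fin, ← hk]
    have h1 : T + 1 ≤ (A + 1) * (1 + k * D) := by rw [hT]; nlinarith
    calc (T + 1) ^ k ≤ ((A + 1) * (1 + k * D)) ^ k := Nat.pow_le_pow_left h1 k
      _ = A * (A + 1) ^ k := by rw [mul_pow, hA]; ring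
      _ < (A + 1) * (A + 1) ^ k := by
        apply Nat.mul_lt_mul_of_pos_right (Nat.lt_succ_self A); positivity
  have hker := LinearMap.ker_ne_bot_of_finrank_lt (f := Φ) hlt
  obtain ⟨c, hc, hc0⟩ := (Submodule.ne_bot_iff _).1 hker
  have hdeg : (∑ ab, c ab • G ab).totalDegree ≤ T := by
    apply totalDegree_finsetSum_le
    intro ab _
    refine (totalDegree_smul_le _ _).trans ?_
    refine (totalDegree_mul _ _).trans ?_
    have h1 : (h ^ (ab.1 : ℕ)).totalDegree ≤ A := by
      refine (totalDegree_pow _ _).trans ?_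
      have := ab.1.is_lt
      nlinarith
    have h2 : (∏ i, p i ^ (ab.2 i : ℕ)).totalDegree ≤ k * (A * D) := by
      refine (totalDegree_finsetProd _ _).trans ?_
      calc _ ≤ ∑ i : σ, A * D := by
            apply Finset.sum_le_sum
            intro i _
            refine (totalDegree_pow _ _).trans ?_
            exact Nat.mul_le_mul (Nat.lt_succ_iff.1 (ab.2 i).is_lt) (hp i)
        _ = _ := by simp [hk]
    omega
  have hzero : (∑ ab, c ab • G ab) = 0 := by
    ext e
    by_cases he : ∀ i, e i < T + 1
    · have := congrFun (LinearMap.mem_ker.1 hc) (fun i => ⟨e i, he i⟩)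
      have he' : toE (fun i => ⟨e i, he i⟩) = e := by ext i; simp [toE]
      simpa [Φ, he'] using this
    · push Not at he
      obtain ⟨i, hi⟩ := he
      rw [coeff_zero]
      apply coeff_eq_zero_of_totalDegree_lt
      have hi0 : i ∈ e.support := by simp; omega
      have := Finset.single_le_sum (f := fun j => e j) (fun _ _ => Nat.zero_le _) hi0
      have h2 : e i ≤ ∑ j ∈ e.support, e j := this
      omega
  obtain ⟨⟨a0, b0⟩, hab⟩ : ∃ ab, c ab ≠ 0 := by
    by_contra hcon; push Not at hcon; exact hc0 (funext hcon)
  let Q : Fin (A + 1) → MvPolynomial σ ℝ := fun a =>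
    ∑ b : σ → Fin (A + 1), monomial (Finsupp.equivFunOnFinite.symm (fun i => (b i : ℕ))) (c (a, b))
  refine ⟨Q a0, ?_, ?_⟩
  · intro hQ
    have := congrArg (coeff (Finsupp.equivFunOnFinite.symm (fun i => (b0 i : ℕ)))) hQ
    simp only [Q, coeff_sum, coeff_monomial, coeff_zero] at this
    rw [Finset.sum_eq_single b0] at this
    · simp at this; exact hab this
    · intro b _ hb
      rw [if_neg]
      intro hbb
      apply hb
      ext i
      have := DFunLike.congr_fun hbb i
      simpa using this
    · simp
  · intro y hy
    refine ⟨∑ a : Fin (A + 1), Polynomial.monomial (a : ℕ) (eval y (Q a)), ?_, ?_, ?_⟩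
    · intro h0
      have := congrArg (fun q => Polynomial.coeff q (a0 : ℕ)) h0
      simp only [Polynomial.finsetSum_coeff, Polynomial.coeff_monomial, Polynomial.coeff_zero] at this
      rw [Finset.sum_eq_single a0] at this
      · simp at this; exact hy this
      · intro b _ hb
        rw [if_neg]
        intro hbb
        exact hb (Fin.ext hbb)
      · simp
    · apply Polynomial.natDegree_sum_le_of_forall_le
      intro a _
      refine (Polynomial.natDegree_monomial_le _).trans ?_
      exact Nat.lt_succ_iff.1 a.is_lt
    · intro x hx
      have := congrArg (eval x) hzero
      simp only [map_sum, smul_eval, map_zero, G, map_mul, map_pow, map_prod, hx, I, Fintype.sum_prod_type] at this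
      rw [Polynomial.eval_finsetSum, ← this]
      apply Finset.sum_congr rfl
      intro a _
      rw [Polynomial.eval_monomial]
      simp only [Q, map_sum, eval_monomial, Finset.sum_mul]
      apply Finset.sum_congr rfl
      intro b _
      rw [Finsupp.prod_fintype _ _ (by simp)]
      simp
      ring

lemma count_fibers {σ S : Type} [Fintype σ] [DecidableEq σ] [Fintype S] [DecidableEq S] (D : ℕ)
    (p : σ → MvPolynomial σ ℝ)
    (hp : ∀ i, (p i).totalDegree ≤ D) (ε : ℝ) (hε : 0 < ε)
    (H : ∀ y : σ → ℝ, (∀ i, |y i| < ε) → ∃ x : S → σ → ℝ, Function.Injective x ∧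
      ∀ s i, eval (x s) (p i) = y i) :
    Fintype.card S ≤ (1 + Fintype.card σ * D) ^ Fintype.card σ := by
  set k := Fintype.card σ with hk
  let idx := Fintype.equivFin σ
  let h : ℕ → MvPolynomial σ ℝ := fun t => ∑ i, C ((t : ℝ) ^ (idx i : ℕ)) * X i
  have hh : ∀ t, (h t).totalDegree ≤ 1 := by
    intro t
    apply totalDegree_finsetSum_le
    intro i _
    refine (totalDegree_mul _ _).trans ?_
    rw [totalDegree_C, totalDegree_X]
  choose R hR0 hR using fun t => elim_poly D p hp (h t) (hh t)
  let N := Fintype.card S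
  let M := N * N * k
  let RR := ∏ t ∈ Finset.range (M + 1), R t
  have hRR : RR ≠ 0 := Finset.prod_ne_zero_iff.2 fun t _ => hR0 t
  obtain ⟨y, hy, hyR⟩ : ∃ y : σ → ℝ, (∀ i, |y i| < ε) ∧ eval y RR ≠ 0 := by
    by_contra hcon
    push Not at hcon
    apply hRR
    apply MvPolynomial.funext_set (fun _ => Set.Ioo (-ε) ε)
    · intro i; exact Set.Ioo_infinite (by linarith)
    · intro y hy
      rw [map_zero]
      exact hcon y (fun i => abs_lt.2 (hy i (Set.mem_univ i)))
  obtain ⟨x, hxinj, hx⟩ := H y hy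
  let w : S × S → Polynomial ℝ := fun ss => ∑ i, Polynomial.monomial (idx i : ℕ) (x ss.1 i - x ss.2 i)
  have hw0 : ∀ ss ∈ (Finset.univ : Finset S).offDiag, w ss ≠ 0 := by
    intro ss hss h0
    simp at hss
    apply hss
    apply hxinj
    ext i
    have := congrArg (fun q => Polynomial.coeff q (idx i : ℕ)) h0
    simp only [w, Polynomial.finsetSum_coeff, Polynomial.coeff_monomial, Polynomial.coeff_zero] at this
    rw [Finset.sum_eq_single i] at this
    · simp at this; linarith
    · intro b _ hb
      rw [if_neg]
      intro hbb
      exact hb (idx.injective (Fin.ext hbb))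
    · simp
  let W := ∏ ss ∈ (Finset.univ : Finset S).offDiag, w ss
  have hW : W ≠ 0 := Finset.prod_ne_zero_iff.2 hw0
  have hWdeg : W.natDegree ≤ M := by
    refine (Polynomial.natDegree_prod_le _ _).trans ?_
    calc _ ≤ ∑ ss ∈ (Finset.univ : Finset S).offDiag, k := by
          apply Finset.sum_le_sum
          intro ss _
          apply Polynomial.natDegree_sum_le_of_forall_le
          intro a _
          refine (Polynomial.natDegree_monomial_le _).trans ?_
          exact (idx a).is_lt.le
      _ ≤ M := by
          rw [Finset.sum_const, smul_eq_mul, Finset.offDiag_card]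
          apply Nat.mul_le_mul_right
          simp [N]
  obtain ⟨t, ht, htW⟩ : ∃ t ∈ Finset.range (M + 1), W.eval (t : ℝ) ≠ 0 := by
    by_contra hcon
    push Not at hcon
    apply hW
    apply Polynomial.eq_zero_of_natDegree_lt_card_of_eval_eq_zero' W
      ((Finset.range (M + 1)).image (fun t : ℕ => (t : ℝ)))
    · intro i hi
      obtain ⟨t, ht, rfl⟩ := Finset.mem_image.1 hi
      exact hcon t ht
    · rw [Finset.card_image_of_injective _ Nat.cast_injective]
      simp; omega
  have hyt : eval y (R t) ≠ 0 := by
    have : ∏ t ∈ Finset.range (M + 1), eval y (R t) ≠ 0 := by rw [← map_prod]; exact hyR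
    exact Finset.prod_ne_zero_iff.1 this t ht
  obtain ⟨q, hq0, hqd, hq⟩ := hR t y hyt
  have hinj : Function.Injective (fun s => eval (x s) (h t)) := by
    intro s s' hss
    by_contra hne
    rw [Polynomial.eval_prod] at htW
    apply Finset.prod_ne_zero_iff.1 htW (s, s') (by simpa using hne)
    simp only [h, map_sum, map_mul, eval_C, eval_X] at hss
    simp only [w, Polynomial.eval_finsetSum, Polynomial.eval_monomial, sub_mul, Finset.sum_sub_distrib]
    simp only [mul_comm] at hss ⊢
    linarith
  by_contra hcon
  push Not at hcon
  apply hq0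
  apply Polynomial.eq_zero_of_natDegree_lt_card_of_eval_eq_zero q hinj
  · intro s; exact hq _ (hx s)
  · exact lt_of_le_of_lt hqd hcon

lemma hasDerivAt_pderiv {σ : Type} [Fintype σ] [DecidableEq σ] (f : MvPolynomial σ ℝ) (x : σ → ℝ)
    (i : σ) (t : ℝ) :
    HasDerivAt (fun t => eval (Function.update x i t) f) (eval (Function.update x i t) (pderiv i f)) t := by
  induction f using MvPolynomial.induction_on with
  | C a => simpa using hasDerivAt_const t a
  | add p q hp hq => simp only [map_add]; exact hp.fun_add hq
  | mul_X p j hp =>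
    have hX : HasDerivAt (fun t => Function.update x i t j) (if j = i then 1 else 0) t := by
      by_cases hj : j = i
      · subst hj; simpa using hasDerivAt_id' t
      · simpa [hj] using hasDerivAt_const t (x j)
    have := hp.fun_mul hX
    simp only [map_mul, eval_X, Derivation.leibniz, pderiv_X, map_add, smul_eq_mul]
    refine this.congr_deriv ?_
    by_cases hj : j = i
    · subst hj; simp; ring
    · simp [hj]; ring

lemma totalDegree_pderiv_le' {σ : Type} [DecidableEq σ] (f : MvPolynomial σ ℝ) (i : σ) (D : ℕ)
    (hf : f.totalDegree ≤ D) : (pderiv i f).totalDegree ≤ D := by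
  rw [f.as_sum, map_sum]
  apply totalDegree_finsetSum_le
  intro e he
  rw [pderiv_monomial]
  refine (totalDegree_monomial_le _ _).trans ?_
  refine le_trans ?_ ((le_totalDegree he).trans hf)
  have : (e - Finsupp.single i 1).degree ≤ e.degree := Finsupp.degree_mono tsub_le_self
  simp only [Finsupp.degree_apply] at this
  exact this

lemma count_boxes {σ S : Type} [Fintype σ] [DecidableEq σ] [Fintype S] [DecidableEq S] (D : ℕ)
    (f : MvPolynomial σ ℝ) (hf : f.totalDegree ≤ D) (hf0 : ∀ x, 0 ≤ eval x f)
    (a b : S → σ → ℝ)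
    (hdisj : ∀ (s s' : S) (x : σ → ℝ), (∀ i, x i ∈ Set.Ioo (a s i) (b s i)) →
      (∀ i, x i ∈ Set.Ioo (a s' i) (b s' i)) → s = s')
    (hz : ∀ s, ∃ x : σ → ℝ, (∀ i, x i ∈ Set.Icc (a s i) (b s i)) ∧ eval x f = 0)
    (hin : ∀ (s : S) (x : σ → ℝ), (∀ i, x i ∈ Set.Icc (a s i) (b s i)) → eval x f = 0 →
      ∀ i, x i ∈ Set.Ioo (a s i) (b s i)) :
    Fintype.card S ≤ (1 + Fintype.card σ * D) ^ Fintype.card σ := by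
  have hcont : Continuous (fun x => eval x f) := MvPolynomial.continuous_eval f
  have key : ∀ s, ∃ ε : ℝ, 0 < ε ∧ ∀ y : σ → ℝ, (∀ i, |y i| < ε) →
      ∃ x : σ → ℝ, (∀ i, x i ∈ Set.Ioo (a s i) (b s i)) ∧ ∀ i, eval x (pderiv i f) = y i := by
    intro s
    obtain ⟨z, hzK, hz0⟩ := hz s
    let K : Set (σ → ℝ) := Set.Icc (a s) (b s)
    let U : Set (σ → ℝ) := Set.univ.pi fun i => Set.Ioo (a s i) (b s i)
    have hmK : ∀ x, x ∈ K ↔ ∀ i, x i ∈ Set.Icc (a s i) (b s i) := by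
      intro x
      simp only [K, Set.mem_Icc, Pi.le_def]
      exact ⟨fun h i => ⟨h.1 i, h.2 i⟩, fun h => ⟨fun i => (h i).1, fun i => (h i).2⟩⟩
    have hmU : ∀ x, x ∈ U ↔ ∀ i, x i ∈ Set.Ioo (a s i) (b s i) := by
      intro x; simp [U]
    have hK : IsCompact K := isCompact_Icc
    have hU : IsOpen U := isOpen_set_pi Set.finite_univ fun i _ => isOpen_Ioo
    have hB : IsCompact (K \ U) := hK.diff hU
    obtain ⟨η, hη, hηB⟩ : ∃ η : ℝ, 0 < η ∧ ∀ x ∈ K \ U, η ≤ eval x f := by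
      rcases (K \ U).eq_empty_or_nonempty with he | hne
      · exact ⟨1, one_pos, by simp [he]⟩
      · obtain ⟨x0, hx0, hmin⟩ := hB.exists_isMinOn hne hcont.continuousOn
        refine ⟨eval x0 f, ?_, fun x hx => hmin hx⟩
        refine lt_of_le_of_ne (hf0 x0) fun h => hx0.2 ?_
        exact (hmU _).2 (hin s x0 ((hmK _).1 hx0.1) h.symm)
    let Λ : ℝ := ∑ i, (b s i - a s i)
    have hab : ∀ i, 0 ≤ b s i - a s i := fun i => by have := hzK i; linarith [this.1, this.2]
    have hΛ : 0 ≤ Λ := Finset.sum_nonneg fun i _ => hab i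
    refine ⟨η / (Λ + 1), by positivity, fun y hy => ?_⟩
    have hg : Continuous fun x : σ → ℝ => eval x f - ∑ i, y i * x i := by fun_prop
    obtain ⟨x, hxK, hmin⟩ := hK.exists_isMinOn ⟨z, (hmK z).2 hzK⟩ hg.continuousOn
    have hxU : x ∈ U := by
      by_contra hxU
      have h1 := hηB x ⟨hxK, hxU⟩
      have h2 : eval x f - ∑ i, y i * x i ≤ eval z f - ∑ i, y i * z i := hmin ((hmK z).2 hzK)
      have h3 : ∑ i, y i * x i - ∑ i, y i * z i ≤ η / (Λ + 1) * Λ := by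
        rw [← Finset.sum_sub_distrib, Finset.mul_sum]
        apply Finset.sum_le_sum
        intro i _
        rw [← mul_sub]
        refine (le_abs_self _).trans ?_
        rw [abs_mul]
        apply mul_le_mul (hy i).le _ (abs_nonneg _) (by positivity)
        have h4 := (hmK x).1 hxK i
        have h5 := hzK i
        rw [abs_le]; constructor <;> linarith [h4.1, h4.2, h5.1, h5.2]
      have h6 : η / (Λ + 1) * Λ < η := by
        rw [div_mul_eq_mul_div, div_lt_iff₀ (by positivity)]
        nlinarith
      linarith
    refine ⟨x, (hmU x).1 hxU, fun i => ?_⟩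
    have hder : HasDerivAt (fun t => eval (Function.update x i t) f - ∑ j, y j * Function.update x i t j)
        (eval (Function.update x i (x i)) (pderiv i f) - y i) (x i) := by
      apply (hasDerivAt_pderiv f x i (x i)).sub
      have : ∀ j ∈ Finset.univ, HasDerivAt (fun t => y j * Function.update x i t j) (if j = i then y i else 0) (x i) := by
        intro j _
        by_cases hj : j = i
        · subst hj; simpa using (hasDerivAt_id' (x j)).const_mul (y j)
        · simpa [hj] using hasDerivAt_const (x i) (y j * x j)
      simpa using HasDerivAt.fun_sum this
    have hloc : IsLocalMin (fun t => eval (Function.update x i t) f - ∑ j, y j * Function.update x i t j) (x i) := by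
      have hc : ContinuousAt (fun t => Function.update x i t) (x i) := by fun_prop
      have hU' : U ∈ nhds (Function.update x i (x i)) := by
        rw [Function.update_eq_self]; exact hU.mem_nhds hxU
      filter_upwards [hc hU'] with t ht
      have htK : Function.update x i t ∈ K := (hmK _).2 fun j => Set.Ioo_subset_Icc_self ((hmU _).1 ht j)
      have := hmin htK
      simpa using this
    have := hloc.hasDerivAt_eq_zero hder
    rw [Function.update_eq_self] at this
    linarith
  choose ε hε hεs using key
  obtain ⟨e, he, hee⟩ : ∃ e : ℝ, 0 < e ∧ ∀ s, e ≤ ε s := by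
    rcases isEmpty_or_nonempty S with hS | hS
    · exact ⟨1, one_pos, fun s => (hS.false s).elim⟩
    · obtain ⟨s0, hs0⟩ := Finite.exists_min ε
      exact ⟨ε s0, hε s0, hs0⟩
  refine count_fibers D (fun i => pderiv i f) (fun i => totalDegree_pderiv_le' f i D hf) e he ?_
  intro y hy
  choose x hx hxp using fun s => hεs s y (fun i => (hy i).trans_le (hee s))
  refine ⟨x, ?_, hxp⟩
  intro s s' hss
  refine hdisj s s' (x s) (hx s) ?_
  rw [hss]; exact hx s'

lemma generic_grid (n q : ℕ) (Z : Set (EuclideanSpace ℝ (Fin n))) (hZ : dimH Z = (q : ℝ≥0∞))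
    (δ : ℝ) : ∃ t : Fin n → ℝ, ∀ z ∈ Z, ∀ J : Finset (Fin n),
      (∀ i ∈ J, ∃ l : ℤ, z i = t i + δ * l) → J.card ≤ q := by
  have hnull : ∀ (J : Finset (Fin n)) (k : Fin n → ℤ), q < J.card → ∀ᵐ t : Fin n → ℝ,
      ¬ ∃ z ∈ Z, ∀ i ∈ J, z i = t i + δ * k i := by
    intro J k hJ
    let π : EuclideanSpace ℝ (Fin n) → ({i // i ∈ J} → ℝ) := fun z i => z i
    have hπ : LipschitzWith 1 π := by
      apply LipschitzWith.of_dist_le_mul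
      intro x y
      rw [NNReal.coe_one, one_mul]
      refine (dist_pi_le_iff dist_nonneg).2 fun i => ?_
      have := PiLp.norm_apply_le (x - y) (i : Fin n)
      simpa [π, dist_eq_norm] using this
    have hN : volume (π '' Z) = 0 := by
      apply measure_zero_of_dimH_lt (d := (J.card : ℝ≥0))
      · have := @hausdorffMeasure_pi_real {i // i ∈ J} _
        simp only [Fintype.card_coe] at this
        rw [NNReal.coe_natCast, this]
      · refine lt_of_le_of_lt (hπ.dimH_image_le Z) ?_
        rw [hZ]
        exact_mod_cast hJ
    let c : {i // i ∈ J} → ℝ := fun i => δ * k i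
    have h1 := (volume_preserving_piEquivPiSubtypeProd (fun _ : Fin n => ℝ) (· ∈ J)).quasiMeasurePreserving
    have hinst : Subtype.fintype (fun x => x ∈ J) = Finset.Subtype.fintype J := Subsingleton.elim _ _
    rw [hinst] at h1
    have h2 : Measure.QuasiMeasurePreserving (Prod.fst : ({i // i ∈ J} → ℝ) × ({i // i ∉ J} → ℝ) → _)
      volume volume := Measure.quasiMeasurePreserving_fst
    have h3 := (measurePreserving_add_right (volume : Measure ({i // i ∈ J} → ℝ)) c).quasiMeasurePreserving
    have h4 := ((h3.comp h2).comp h1).preimage_null hN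
    rw [ae_iff]
    refine measure_mono_null ?_ h4
    intro t ht
    simp only [not_not, Set.mem_ofPred_eq] at ht
    obtain ⟨z, hz, hzt⟩ := ht
    refine ⟨z, hz, ?_⟩
    ext i
    simp only [π, hzt i i.2]
    rfl
  have hall : ∀ᵐ t : Fin n → ℝ, ∀ (J : Finset (Fin n)) (k : Fin n → ℤ), q < J.card →
      ¬ ∃ z ∈ Z, ∀ i ∈ J, z i = t i + δ * k i := by
    rw [ae_all_iff]; intro J
    rw [ae_all_iff]; intro k
    by_cases h : q < J.card
    · filter_upwards [hnull J k h] with t ht _ using ht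
    · exact Filter.Eventually.of_forall fun t h' => absurd h' h
  obtain ⟨t, ht⟩ := hall.exists
  refine ⟨t, fun z hz J hJ => ?_⟩
  by_contra hcon
  push Not at hcon
  choose! l hl using hJ
  exact ht J l hcon ⟨z, hz, hl⟩

lemma totalDegree_aeval_le {σ τ : Type} (f : MvPolynomial σ ℝ) (g : σ → MvPolynomial τ ℝ)
    (hg : ∀ i, (g i).totalDegree ≤ 1) : (aeval g f).totalDegree ≤ f.totalDegree := by
  conv_lhs => rw [f.as_sum, map_sum]
  apply totalDegree_finsetSum_le
  intro e he
  rw [aeval_monomial]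
  refine (totalDegree_mul _ _).trans ?_
  have h1 : (algebraMap ℝ (MvPolynomial τ ℝ) (coeff e f)).totalDegree = 0 := totalDegree_C _
  rw [h1, zero_add]
  refine le_trans ?_ (le_totalDegree he)
  refine (totalDegree_finsetProd _ _).trans ?_
  apply Finset.sum_le_sum
  intro i _
  refine (totalDegree_pow _ _).trans ?_
  have := Nat.mul_le_mul_left (e i) (hg i)
  simpa using this

open Classical in
lemma count_cubes (n D q M : ℕ) (f : MvPolynomial (Fin n) ℝ) (hf : f.totalDegree ≤ D)
    (hf0 : ∀ x, 0 ≤ eval x f) (t : Fin n → ℝ) (δ : ℝ) (hδ : 0 < δ)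
    (hgen : ∀ z : Fin n → ℝ, eval z f = 0 → ∀ J : Finset (Fin n),
      (∀ i ∈ J, ∃ l : ℤ, z i = t i + δ * l) → J.card ≤ q)
    (L : Fin n → Finset ℤ) (hL : ∀ i, (L i).card ≤ M)
    (K : Finset (Fin n → ℤ)) (hKL : ∀ k ∈ K, ∀ i, k i ∈ L i)
    (hK : ∀ k ∈ K, ∃ z : Fin n → ℝ, eval z f = 0 ∧
      ∀ i, z i ∈ Set.Icc (t i + δ * k i) (t i + δ * (k i + 1))) :
    K.card ≤ ∑ J ∈ (Finset.univ : Finset (Finset (Fin n))).filter (fun J => J.card ≤ q),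
      (1 + (n - J.card) * D) ^ (n - J.card) * (2 ^ n * M ^ J.card) := by
  let P : (Fin n → ℤ) → (Fin n → ℝ) → Prop := fun k z => eval z f = 0 ∧
      ∀ i, z i ∈ Set.Icc (t i + δ * k i) (t i + δ * (k i + 1))
  let grid : (Fin n → ℝ) → Finset (Fin n) := fun z =>
    Finset.univ.filter fun i => ∃ l : ℤ, z i = t i + δ * l
  have hmax : ∀ k ∈ K, ∃ z, P k z ∧ ∀ w, P k w → (grid w).card ≤ (grid z).card := by
    intro k hk
    have hex : ∃ c, ∃ z, P k z ∧ n - (grid z).card = c := by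
      obtain ⟨z, hz⟩ := hK k hk
      exact ⟨_, z, hz, rfl⟩
    obtain ⟨z, hz, hzc⟩ := Nat.find_spec hex
    refine ⟨z, hz, fun w hw => ?_⟩
    have h1 := Nat.find_min' hex ⟨w, hw, rfl⟩
    have h2 := Finset.card_le_univ (grid w)
    have h3 := Finset.card_le_univ (grid z)
    simp only [Fintype.card_fin] at h2 h3
    omega
  choose! z hzP hzmax using hmax
  have hmaps : Set.MapsTo (fun k => grid (z k)) (K : Set (Fin n → ℤ))
      ((Finset.univ : Finset (Finset (Fin n))).filter (fun J => J.card ≤ q)) := by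
    intro k hk
    have hk' : k ∈ K := hk
    simp only [Finset.coe_filter, Finset.mem_univ, true_and, Set.mem_ofPred_eq]
    apply hgen (z k) (hzP k hk').1
    intro i hi
    simpa [grid] using hi
  rw [Finset.card_eq_sum_card_fiberwise hmaps]
  apply Finset.sum_le_sum
  intro J _
  let e : (Fin n → ℤ) → Fin n → Bool := fun k i => decide (z k i = t i + δ * (k i + 1))
  let Ψ : (Fin n → ℤ) → (Fin n → Bool) × ({i // i ∈ J} → ℤ) := fun k => (e k, fun i => k i)
  have him : (Finset.image Ψ (K.filter fun k => grid (z k) = J)).card ≤ 2 ^ n * M ^ J.card := by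
    calc _ ≤ ((Finset.univ : Finset (Fin n → Bool)) ×ˢ
          Fintype.piFinset (fun i : {i // i ∈ J} => L i)).card := by
          apply Finset.card_le_card
          intro x hx
          obtain ⟨k, hk, rfl⟩ := Finset.mem_image.1 hx
          simp only [Finset.mem_product, Finset.mem_univ, true_and, Fintype.mem_piFinset, Ψ]
          exact fun i => hKL k (Finset.mem_filter.1 hk).1 i
      _ ≤ _ := by
          rw [Finset.card_product, Fintype.card_piFinset]
          apply Nat.mul_le_mul
          · simp
          · calc _ ≤ ∏ i : {i // i ∈ J}, M := Finset.prod_le_prod' fun i _ => hL i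
              _ = _ := by simp
  refine (Finset.card_le_mul_card_image (f := Ψ) _ ((1 + (n - J.card) * D) ^ (n - J.card)) ?_).trans
    (Nat.mul_le_mul_left _ him)
  rintro ⟨ε, κ⟩ _
  set Sf := ((K.filter fun k => grid (z k) = J).filter fun k => Ψ k = (ε, κ)) with hSf
  have hS : ∀ k ∈ Sf, k ∈ K ∧ grid (z k) = J ∧ e k = ε ∧ ∀ i : {i // i ∈ J}, k i = κ i := by
    intro k hk
    simp only [hSf, Finset.mem_filter, Ψ, Prod.mk.injEq] at hk
    exact ⟨hk.1.1, hk.1.2, hk.2.1, fun i => congrFun hk.2.2 i⟩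
  let v : {i // i ∈ J} → ℝ := fun i => t i + δ * (κ i + if ε i = true then 1 else 0)
  let ext : ({i // i ∉ J} → ℝ) → Fin n → ℝ := fun x i => if h : i ∈ J then v ⟨i, h⟩ else x ⟨i, h⟩
  let g : Fin n → MvPolynomial {i // i ∉ J} ℝ := fun i => if h : i ∈ J then C (v ⟨i, h⟩) else X ⟨i, h⟩
  have hev : ∀ x, eval x (aeval g f) = eval (ext x) f := by
    intro x
    have : (eval x).comp ((aeval g : MvPolynomial (Fin n) ℝ →ₐ[ℝ] _) : MvPolynomial (Fin n) ℝ →+* _)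
        = eval (ext x) := by
      apply MvPolynomial.ringHom_ext
      · intro r; simp
      · intro i
        by_cases h : i ∈ J <;> simp [g, ext, h]
    exact RingHom.congr_fun this f
  have hdeg : (aeval g f).totalDegree ≤ D := by
    refine (totalDegree_aeval_le f g fun i => ?_).trans hf
    by_cases h : i ∈ J <;> simp [g, h]
  have hzv : ∀ k ∈ Sf, ∀ i (h : i ∈ J), z k i = v ⟨i, h⟩ := by
    intro k hk i h
    obtain ⟨hkK, hkJ, hke, hkκ⟩ := hS k hk
    have hi : i ∈ grid (z k) := by rw [hkJ]; exact h
    obtain ⟨l, hl⟩ : ∃ l : ℤ, z k i = t i + δ * l := by simpa [grid] using hi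
    have hI := (hzP k hkK).2 i
    have hei : ε i = decide (z k i = t i + δ * (k i + 1)) := by rw [← hke]
    have hki : k i = κ ⟨i, h⟩ := hkκ ⟨i, h⟩
    simp only [v, hei, decide_eq_true_eq, ← hki]
    by_cases hc : z k i = t i + δ * (k i + 1)
    · rw [if_pos hc, hc]
    · rw [if_neg hc, add_zero]
      have h1 : (k i : ℝ) ≤ l := by
        have := hI.1; rw [hl] at this
        exact le_of_mul_le_mul_left (by linarith) hδ
      have h2 : (l : ℝ) ≤ k i + 1 := by
        have := hI.2; rw [hl] at this
        exact le_of_mul_le_mul_left (by linarith) hδ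
      have h3 : (l : ℝ) ≠ k i + 1 := by
        intro h3; rw [hl, h3] at hc; exact hc rfl
      have h1' : k i ≤ l := by exact_mod_cast h1
      have h2' : l ≤ k i + 1 := by exact_mod_cast h2
      have h3' : l ≠ k i + 1 := by exact_mod_cast h3
      have : l = k i := by omega
      rw [hl, this]
  have hcount := count_boxes (σ := {i // i ∉ J}) (S := {k // k ∈ Sf}) D (aeval g f) hdeg
    (fun x => by rw [hev]; exact hf0 _)
    (fun k i => t i + δ * (k.1 i)) (fun k i => t i + δ * (k.1 i + 1)) ?_ ?_ ?_
  · have hcard : Fintype.card {i // i ∉ J} = n - J.card := by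
      rw [Fintype.card_subtype_compl]; simp
    rw [hcard] at hcount
    simpa using hcount
  · rintro ⟨k, hk⟩ ⟨k', hk'⟩ x hx hx'
    rw [Subtype.mk.injEq]
    ext i
    by_cases h : i ∈ J
    · rw [(hS k hk).2.2.2 ⟨i, h⟩, (hS k' hk').2.2.2 ⟨i, h⟩]
    · have h1 := hx ⟨i, h⟩
      have h2 := hx' ⟨i, h⟩
      simp only [Set.mem_Ioo] at h1 h2
      have h3 : (k i : ℝ) < k' i + 1 := lt_of_mul_lt_mul_left (by linarith [h1.1, h2.2]) hδ.le
      have h4 : (k' i : ℝ) < k i + 1 := lt_of_mul_lt_mul_left (by linarith [h1.2, h2.1]) hδ.le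
      have h3' : k i < k' i + 1 := by exact_mod_cast h3
      have h4' : k' i < k i + 1 := by exact_mod_cast h4
      omega
  · rintro ⟨k, hk⟩
    refine ⟨fun i => z k i, fun i => (hzP k (hS k hk).1).2 i, ?_⟩
    rw [hev]
    have : ext (fun i => z k i) = z k := by
      funext i
      by_cases h : i ∈ J
      · simp [ext, h, hzv k hk i h]
      · simp [ext, h]
    rw [this]
    exact (hzP k (hS k hk).1).1
  · rintro ⟨k, hk⟩ x hx hx0
    obtain ⟨hkK, hkJ, hke, hkκ⟩ := hS k hk
    rw [hev] at hx0
    have hPw : P k (ext x) := by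
      refine ⟨hx0, fun i => ?_⟩
      by_cases h : i ∈ J
      · have := (hzP k hkK).2 i
        rw [hzv k hk i h] at this
        simpa only [ext, h, dif_pos] using this
      · simpa only [ext, h, dif_neg, not_false_eq_true] using hx ⟨i, h⟩
    have hsub : J ⊆ grid (ext x) := by
      intro i h
      simp only [grid, Finset.mem_filter, Finset.mem_univ, true_and, ext, h, dif_pos, v]
      refine ⟨κ ⟨i, h⟩ + if ε i = true then 1 else 0, ?_⟩
      push_cast
      rfl
    have hEq : J = grid (ext x) := by
      apply Finset.eq_of_subset_of_card_le hsub
      rw [← hkJ]; exact hzmax k hkK _ hPw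
    rintro ⟨i, h⟩
    have hng : ¬ ∃ l : ℤ, x ⟨i, h⟩ = t i + δ * l := by
      intro hl
      apply h
      rw [hEq]
      simpa [grid, ext, h] using hl
    have hxi := hx ⟨i, h⟩
    refine ⟨lt_of_le_of_ne hxi.1 fun h' => hng ⟨k i, h'.symm⟩,
      lt_of_le_of_ne hxi.2 fun h' => hng ⟨k i + 1, by push_cast; exact h'⟩⟩

lemma exists_single_poly {n d : ℕ} {ι : Type} (F : ι → MvPolynomial (Fin n) ℝ)
    (hF : ∀ i, (F i).totalDegree ≤ d) :
    ∃ f : MvPolynomial (Fin n) ℝ, f.totalDegree ≤ 2 * d ∧ (∀ x, 0 ≤ eval x f) ∧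
      ∀ x, eval x f = 0 ↔ ∀ i, eval x (F i) = 0 := by
  have hfg : (Submodule.span (MvPolynomial (Fin n) ℝ) (Set.range F)).FG := IsNoetherian.noetherian _
  obtain ⟨s, hs, hspan⟩ := (Submodule.fg_span_iff_fg_span_finset_subset _).1 hfg
  have hev : ∀ x, eval x (∑ p ∈ s, p ^ 2) = ∑ p ∈ s, (eval x p) ^ 2 := by intro x; simp
  refine ⟨∑ p ∈ s, p ^ 2, ?_, ?_, ?_⟩
  · apply totalDegree_finsetSum_le
    intro p hp
    obtain ⟨i, rfl⟩ := hs hp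
    exact (totalDegree_pow _ _).trans (Nat.mul_le_mul_left 2 (hF i))
  · intro x
    rw [hev]
    exact Finset.sum_nonneg fun p _ => sq_nonneg _
  · intro x
    rw [hev, Finset.sum_eq_zero_iff_of_nonneg fun p _ => sq_nonneg _]
    constructor
    · intro h i
      have hle : Submodule.span (MvPolynomial (Fin n) ℝ) (s : Set (MvPolynomial (Fin n) ℝ)) ≤
          RingHom.ker (eval x) := by
        apply Submodule.span_le.2
        intro p hp
        exact (RingHom.mem_ker).2 (pow_eq_zero_iff (two_ne_zero)|>.1 (h p hp))
      have : F i ∈ Submodule.span (MvPolynomial (Fin n) ℝ) (Set.range F) :=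
        Submodule.subset_span ⟨i, rfl⟩
      rw [hspan] at this
      exact (RingHom.mem_ker).1 (hle this)
    · intro h p hp
      obtain ⟨i, rfl⟩ := hs hp
      rw [h i]; norm_num

lemma volume_box (n : ℕ) (a b : Fin n → ℝ) :
    volume {x : EuclideanSpace ℝ (Fin n) | ∀ i, x i ∈ Set.Icc (a i) (b i)} =
      ∏ i, ENNReal.ofReal (b i - a i) := by
  rw [← Real.volume_Icc_pi, ← (PiLp.volume_preserving_ofLp (Fin n)).measure_preimage
    measurableSet_Icc.nullMeasurableSet]
  congr 1
  ext x
  simp only [Set.mem_preimage, Set.mem_Icc, Pi.le_def]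
  exact ⟨fun h => ⟨fun i => (h i).1, fun i => (h i).2⟩, fun h i => ⟨h.1 i, h.2 i⟩⟩

lemma final_arith (n m d : ℕ) (hd : 1 ≤ d) (hmn : m ≤ n) (r δ : ℝ) (hr : 0 < r) (hδ : 0 < δ)
    (j : ℕ) (hj : j ≤ n - m) (M : ℝ) (hM0 : 0 ≤ M) (hM : M ≤ 2 * r / δ + 4) :
    (1 + (n - j : ℕ) * (2 * d : ℝ)) ^ (n - j) * (2 ^ n * M ^ j) * (3 * δ) ^ n ≤
      (36 * (2 * n + 1)) ^ n * (((d : ℝ) * δ) ^ m * r ^ (n - m) + ((d : ℝ) * δ) ^ n) := by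
  have hd' : (1 : ℝ) ≤ d := by exact_mod_cast hd
  set s := (d : ℝ) * δ with hs
  have hs0 : 0 < s := by positivity
  have hδs : δ ≤ s := by rw [hs]; nlinarith
  have h1 : (1 + (n - j : ℕ) * (2 * d : ℝ)) ≤ (2 * n + 1) * d := by
    have : ((n - j : ℕ) : ℝ) ≤ n := by exact_mod_cast Nat.sub_le n j
    nlinarith
  have h2 : (1 + (n - j : ℕ) * (2 * d : ℝ)) ^ (n - j) ≤ (2 * n + 1) ^ n * (d : ℝ) ^ (n - j) := by
    calc _ ≤ ((2 * n + 1) * (d : ℝ)) ^ (n - j) := pow_le_pow_left₀ (by positivity) h1 _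
      _ = (2 * n + 1 : ℝ) ^ (n - j) * (d : ℝ) ^ (n - j) := mul_pow _ _ _
      _ ≤ _ := by
        apply mul_le_mul_of_nonneg_right _ (by positivity)
        exact pow_le_pow_right₀ (by linarith [Nat.cast_nonneg (α := ℝ) n]) (Nat.sub_le n j)
  have hMδ : M * δ ≤ 2 * r + 4 * s := by
    calc M * δ ≤ (2 * r / δ + 4) * δ := mul_le_mul_of_nonneg_right hM hδ.le
      _ = 2 * r + 4 * δ := by field_simp
      _ ≤ _ := by linarith
  have hjn : j ≤ n := hj.trans (Nat.sub_le _ _)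
  have h3 : (d : ℝ) ^ (n - j) * M ^ j * δ ^ n = s ^ (n - j) * (M * δ) ^ j := by
    conv_lhs => rw [← Nat.sub_add_cancel hjn, pow_add δ, Nat.sub_add_cancel hjn]
    rw [hs, mul_pow, mul_pow]; ring
  have h6 : (1 : ℝ) ≤ 6 := by norm_num
  have h4 : s ^ (n - j) * (M * δ) ^ j ≤ 6 ^ n * (s ^ m * r ^ (n - m) + s ^ n) := by
    rcases le_total r s with h | h
    · have : (M * δ) ^ j ≤ (6 * s) ^ j := pow_le_pow_left₀ (by positivity) (by linarith) j
      calc _ ≤ s ^ (n - j) * (6 * s) ^ j := mul_le_mul_of_nonneg_left this (by positivity)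
        _ = 6 ^ j * s ^ n := by
          conv_rhs => rw [← Nat.sub_add_cancel hjn, pow_add s]
          rw [mul_pow]; ring
        _ ≤ 6 ^ n * s ^ n := mul_le_mul_of_nonneg_right (pow_le_pow_right₀ h6 hjn) (by positivity)
        _ ≤ _ := by
          apply mul_le_mul_of_nonneg_left _ (by positivity)
          have : 0 ≤ s ^ m * r ^ (n - m) := by positivity
          linarith
    · have : (M * δ) ^ j ≤ (6 * r) ^ j := pow_le_pow_left₀ (by positivity) (by linarith) j
      calc _ ≤ s ^ (n - j) * (6 * r) ^ j := mul_le_mul_of_nonneg_left this (by positivity)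
        _ = 6 ^ j * (s ^ m * (s ^ (n - m - j) * r ^ j)) := by
          have : n - j = m + (n - m - j) := by omega
          rw [this, mul_pow, pow_add]; ring
        _ ≤ 6 ^ n * (s ^ m * (r ^ (n - m - j) * r ^ j)) := by
          gcongr
        _ = 6 ^ n * (s ^ m * r ^ (n - m)) := by
          rw [← pow_add, Nat.sub_add_cancel hj]
        _ ≤ _ := by
          apply mul_le_mul_of_nonneg_left _ (by positivity)
          have : 0 ≤ s ^ n := by positivity
          linarith
  calc _ ≤ ((2 * n + 1) ^ n * (d : ℝ) ^ (n - j)) * (2 ^ n * M ^ j) * (3 * δ) ^ n := by gcongr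
    _ = (2 * n + 1) ^ n * 2 ^ n * 3 ^ n * ((d : ℝ) ^ (n - j) * M ^ j * δ ^ n) := by
      rw [mul_pow]; ring
    _ ≤ (2 * n + 1) ^ n * 2 ^ n * 3 ^ n * (6 ^ n * (s ^ m * r ^ (n - m) + s ^ n)) := by
      rw [h3]; gcongr
    _ = _ := by
      have : (36 * (2 * n + 1) : ℝ) ^ n = (2 * n + 1) ^ n * 2 ^ n * 3 ^ n * 6 ^ n := by
        rw [← mul_pow, ← mul_pow, ← mul_pow]; congr 1; ring
      rw [this]; ring

lemma main_case (n m d : ℕ) (hmn : m ≤ n) (hd : 1 ≤ d) (Z : Set (EuclideanSpace ℝ (Fin n)))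
    (f : MvPolynomial (Fin n) ℝ) (hf : f.totalDegree ≤ 2 * d) (hf0 : ∀ x, 0 ≤ eval x f)
    (hZf : ∀ x : EuclideanSpace ℝ (Fin n), x ∈ Z ↔ eval (fun j => x j) f = 0)
    (hdim : dimH Z = ((n - m : ℕ) : ℝ≥0∞)) (r : ℝ) (hr : 0 < r) (δ : ℝ) (hδ : 0 < δ) :
    volume (thickening δ Z ∩ cube n r) ≤
      ENNReal.ofReal ((72 * (2 * n + 1)) ^ n *
        (((d : ℝ) * δ) ^ m * r ^ (n - m) + ((d : ℝ) * δ) ^ n)) := by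
  classical
  obtain ⟨t, ht⟩ := generic_grid n (n - m) Z hdim δ
  have hgen : ∀ z : Fin n → ℝ, eval z f = 0 → ∀ J : Finset (Fin n),
      (∀ i ∈ J, ∃ l : ℤ, z i = t i + δ * l) → J.card ≤ n - m := by
    intro z hz J hJ
    exact ht (WithLp.toLp 2 z) ((hZf _).2 hz) J hJ
  let lo : Fin n → ℤ := fun i => ⌊(-r - δ - t i) / δ⌋
  let hi : Fin n → ℤ := fun i => ⌊(r + δ - t i) / δ⌋
  let L : Fin n → Finset ℤ := fun i => Finset.Icc (lo i) (hi i)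
  let M : ℕ := ⌊2 * r / δ + 4⌋₊
  have hMle : (M : ℝ) ≤ 2 * r / δ + 4 := Nat.floor_le (by positivity)
  have hL : ∀ i, (L i).card ≤ M := by
    intro i
    simp only [L, Int.card_Icc]
    apply Nat.le_floor
    have h1 : ((hi i : ℤ) : ℝ) ≤ (r + δ - t i) / δ := Int.floor_le _
    have h2 : (-r - δ - t i) / δ < (lo i : ℝ) + 1 := Int.lt_floor_add_one _
    have h3 : (r + δ - t i) / δ - (-r - δ - t i) / δ = 2 * r / δ + 2 := by field_simp; ring
    rcases le_total 0 (hi i + 1 - lo i) with h | h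
    · have h4 : (((hi i + 1 - lo i).toNat : ℤ) : ℝ) = (hi i : ℝ) + 1 - lo i := by
        rw [Int.toNat_of_nonneg h]; push_cast; ring
      rw [Int.cast_natCast] at h4
      rw [h4]; linarith
    · rw [Int.toNat_of_nonpos h]
      simp; positivity
  let K : Finset (Fin n → ℤ) := (Fintype.piFinset L).filter fun k =>
    ∃ z : Fin n → ℝ, eval z f = 0 ∧ ∀ i, z i ∈ Set.Icc (t i + δ * k i) (t i + δ * (k i + 1))
  have hcount := count_cubes n (2 * d) (n - m) M f hf hf0 t δ hδ hgen L hL K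
    (fun k hk i => Fintype.mem_piFinset.1 (Finset.mem_filter.1 hk).1 i)
    (fun k hk => (Finset.mem_filter.1 hk).2)
  let B : (Fin n → ℤ) → Set (EuclideanSpace ℝ (Fin n)) := fun k =>
    {x | ∀ i, x i ∈ Set.Icc (t i + δ * (k i - 1)) (t i + δ * (k i + 2))}
  have hB : ∀ k, volume (B k) = ENNReal.ofReal ((3 * δ) ^ n) := by
    intro k
    rw [volume_box, ENNReal.ofReal_pow (by positivity)]
    have : ∀ i, t i + δ * (k i + 2) - (t i + δ * (k i - 1)) = 3 * δ := by intro i; ring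
    simp [this]
  have hcover : thickening δ Z ∩ cube n r ⊆ ⋃ k ∈ K, B k := by
    rintro x ⟨hxZ, hxr⟩
    obtain ⟨z, hz, hxz⟩ := mem_thickening_iff.1 hxZ
    have hco : ∀ i, |x i - z i| < δ := by
      intro i
      have := PiLp.norm_apply_le (x - z) i
      rw [dist_eq_norm] at hxz
      simp only [PiLp.sub_apply, Real.norm_eq_abs] at this
      linarith
    let k : Fin n → ℤ := fun i => ⌊(z i - t i) / δ⌋
    have hk1 : ∀ i, t i + δ * k i ≤ z i := by
      intro i
      have : (k i : ℝ) ≤ (z i - t i) / δ := Int.floor_le _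
      rw [le_div_iff₀ hδ] at this
      linarith
    have hk2 : ∀ i, z i ≤ t i + δ * (k i + 1) := by
      intro i
      have : (z i - t i) / δ < k i + 1 := Int.lt_floor_add_one _
      rw [div_lt_iff₀ hδ] at this
      linarith
    have hkK : k ∈ K := by
      refine Finset.mem_filter.2 ⟨Fintype.mem_piFinset.2 fun i => ?_, fun i => z i, (hZf z).1 hz,
        fun i => ⟨hk1 i, hk2 i⟩⟩
      have h1 := abs_lt.1 (hco i)
      have h2 := hxr i
      simp only [Set.mem_Ioo] at h2
      refine Finset.mem_Icc.2 ⟨Int.floor_le_floor ?_, Int.floor_le_floor ?_⟩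
      · apply div_le_div_of_nonneg_right _ hδ.le; linarith
      · apply div_le_div_of_nonneg_right _ hδ.le; linarith
    refine Set.mem_biUnion hkK fun i => ?_
    have h1 := abs_lt.1 (hco i)
    have h2 := hk1 i
    have h3 := hk2 i
    constructor <;> linarith
  have hreal : (K.card : ℝ) * (3 * δ) ^ n ≤ (72 * (2 * n + 1)) ^ n *
        (((d : ℝ) * δ) ^ m * r ^ (n - m) + ((d : ℝ) * δ) ^ n) := by
    have hc : (K.card : ℝ) ≤
        ∑ J ∈ (Finset.univ : Finset (Finset (Fin n))).filter (fun J => J.card ≤ n - m),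
        (1 + (n - J.card : ℕ) * (2 * d : ℝ)) ^ (n - J.card) * (2 ^ n * (M : ℝ) ^ J.card) := by
      have : (K.card : ℝ) ≤ ((∑ J ∈ (Finset.univ : Finset (Finset (Fin n))).filter
        (fun J => J.card ≤ n - m),
        (1 + (n - J.card) * (2 * d)) ^ (n - J.card) * (2 ^ n * M ^ J.card) : ℕ) : ℝ) := by
        exact_mod_cast (hcount.trans_eq (Finset.sum_congr (by congr) fun _ _ => rfl))
      refine this.trans_eq ?_
      rw [Nat.cast_sum]
      apply Finset.sum_congr rfl
      intro J _
      simp only [Nat.cast_mul, Nat.cast_pow, Nat.cast_add, Nat.cast_one, Nat.cast_ofNat]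
    set X := (36 * (2 * n + 1) : ℝ) ^ n * (((d : ℝ) * δ) ^ m * r ^ (n - m) + ((d : ℝ) * δ) ^ n) with hX
    have hX0 : 0 ≤ X := by positivity
    calc _ ≤ (∑ J ∈ (Finset.univ : Finset (Finset (Fin n))).filter (fun J => J.card ≤ n - m),
        (1 + (n - J.card : ℕ) * (2 * d : ℝ)) ^ (n - J.card) * (2 ^ n * (M : ℝ) ^ J.card)) *
          (3 * δ) ^ n := by gcongr
      _ ≤ ∑ J ∈ (Finset.univ : Finset (Finset (Fin n))).filter (fun J => J.card ≤ n - m), X := by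
        rw [Finset.sum_mul]
        apply Finset.sum_le_sum
        intro J hJ
        exact final_arith n m d hd hmn r δ hr hδ J.card (Finset.mem_filter.1 hJ).2 M
          (Nat.cast_nonneg _) hMle
      _ ≤ ∑ J : Finset (Fin n), X :=
        Finset.sum_le_sum_of_subset_of_nonneg (Finset.filter_subset _ _) fun _ _ _ => hX0
      _ = 2 ^ n * X := by simp
      _ = _ := by
        rw [hX, ← mul_assoc, ← mul_pow]; congr 2; ring
  calc volume (thickening δ Z ∩ cube n r) ≤ volume (⋃ k ∈ K, B k) := measure_mono hcover
    _ ≤ ∑ k ∈ K, volume (B k) := measure_biUnion_finset_le _ _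
    _ = ENNReal.ofReal ((K.card : ℝ) * (3 * δ) ^ n) := by
      simp only [hB, Finset.sum_const, nsmul_eq_mul]
      rw [ENNReal.ofReal_mul (Nat.cast_nonneg _), ENNReal.ofReal_natCast]
    _ ≤ _ := ENNReal.ofReal_le_ofReal hreal

/-- If `Z ⊆ ℝⁿ` is a real algebraic variety of codimension `m` (the common zero set of a
family of real polynomials of degree at most `d`, with Hausdorff dimension `n - m`), then
there is a positive constant `C` depending only on `n` such that for all `r > 0`, `δ > 0`,
`vol (Z_δ ∩ Δ_r^n) ≤ C ((dδ)^m r^(n-m) + (dδ)^n)`. -/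
theorem statement1 (n : ℕ) :
    ∃ C : ℝ, 0 < C ∧
      ∀ (m d : ℕ), m ≤ n →
        ∀ Z : Set (EuclideanSpace ℝ (Fin n)),
          (∃ (ι : Type) (F : ι → MvPolynomial (Fin n) ℝ),
              (∀ i, (F i).totalDegree ≤ d) ∧
              Z = {x : EuclideanSpace ℝ (Fin n) | ∀ i, eval (fun j => x j) (F i) = 0}) →
          dimH Z = ((n - m : ℕ) : ℝ≥0∞) →
          ∀ r : ℝ, 0 < r → ∀ δ : ℝ, 0 < δ →
            volume (thickening δ Z ∩ cube n r) ≤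
              ENNReal.ofReal (C * (((d : ℝ) * δ) ^ m * r ^ (n - m) + ((d : ℝ) * δ) ^ n)) := by
  refine ⟨(72 * (2 * n + 1)) ^ n, by positivity, ?_⟩
  rintro m d hmn Z ⟨ι, F, hF, hZ⟩ hdim r hr δ hδ
  rcases Nat.eq_zero_or_pos d with hd | hd
  · rcases Z.eq_empty_or_nonempty with he | ⟨z, hz⟩
    · rw [he]; simp
    · have huniv : Z = Set.univ := by
        rw [Set.eq_univ_iff_forall]
        intro x
        rw [hZ] at hz ⊢
        intro i
        have hzi := hz i
        have hC := totalDegree_eq_zero_iff_eq_C.1 (Nat.le_zero.1 (hd ▸ hF i))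
        rw [hC, eval_C] at hzi ⊢
        exact hzi
      have hm : m = 0 := by
        rw [huniv, Real.dimH_univ_eq_finrank, finrank_euclideanSpace_fin] at hdim
        have : n = n - m := by exact_mod_cast hdim
        omega
      subst hm
      have hsub : thickening δ Z ∩ cube n r ⊆
          {x : EuclideanSpace ℝ (Fin n) | ∀ i, x i ∈ Set.Icc (-r) r} :=
        fun x hx i => Set.Ioo_subset_Icc_self (hx.2 i)
      refine (measure_mono hsub).trans ?_
      rw [volume_box n (fun _ => -r) (fun _ => r)]
      simp only [Finset.prod_const, Finset.card_univ, Fintype.card_fin]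
      rw [← ENNReal.ofReal_pow (by linarith)]
      apply ENNReal.ofReal_le_ofReal
      simp only [pow_zero, one_mul, Nat.sub_zero]
      have h1 : (r - -r) ^ n ≤ (72 * (2 * n + 1) * r) ^ n := by
        apply pow_le_pow_left₀ (by linarith)
        have : (0 : ℝ) ≤ n := Nat.cast_nonneg n
        nlinarith [mul_nonneg this hr.le]
      rw [mul_pow] at h1
      have h2 : 0 ≤ (72 * (2 * n + 1) : ℝ) ^ n * ((d : ℝ) * δ) ^ n := by positivity
      rw [mul_add]
      linarith
  · obtain ⟨f, hf, hf0, hfZ⟩ := exists_single_poly F hF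
    refine main_case n m d hmn hd Z f hf hf0 (fun x => ?_) hdim r hr δ hδ
    rw [hfZ, hZ]
    rfl
end

section
/- Let P be a real polynomial on ℝ^n and let α = (α_1,…,α_n) ∈ ℕ^n be such that x^α = x_1^{α_1}⋯x_n^{α_n} is an admissible monomial for P, with coefficient a_α. Then there exists a real algebraic set Z_α ⊆ ℝ^n (a finite union of zero sets of real polynomials) such that Z(P) ∪ Z_α has Hausdorff dimension n − 1 and, for every x ∈ ℝ^n, d(x, Z(P) ∪ Z_α) ≤ (4/|a_α|^{1/|α|}) · |P(x)|^{1/|α|}. -/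
open MeasureTheory Metric MvPolynomial
open scoped ENNReal NNReal

/-- `α` is an admissible index (i.e. `x^α` is an admissible monomial) for the real
polynomial `P` on `ℝ^n`. -/
def IsAdmissibleIndex {n : ℕ} (P : MvPolynomial (Fin n) ℝ) (α : Fin n →₀ ℕ) : Prop :=
  MvPolynomial.coeff α P ≠ 0 ∧
  ∃ σ : Equiv.Perm (Fin n),
    (∃ h : 0 < n, 1 ≤ α (σ ⟨0, h⟩)) ∧
    ∀ β : Fin n →₀ ℕ, β ≠ α → MvPolynomial.coeff β P ≠ 0 →
      ∃ j : Fin n, β (σ j) < α (σ j) ∧ ∀ k : Fin n, k < j → α (σ k) = β (σ k)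

/-- Chebyshev's extremal property on `[c - r, c + r]`. -/
theorem loj_cheb (p : Polynomial ℝ) (e : ℕ) (hp : p.natDegree ≤ e) (c r M : ℝ) (hr : 0 < r)
    (hM : 0 < M) (h : ∀ t ∈ Set.Icc (c - r) (c + r), |p.eval t| ≤ M) :
    |p.coeff e| * r ^ e ≤ 2 ^ e * M := by
  have key : ∀ s : ℝ, |s| = 1 → s * (p.coeff e * r ^ e) ≤ 2 ^ e * M := by
    intro s hs
    set q : Polynomial ℝ := Polynomial.C (s * M⁻¹) * p.comp (Polynomial.C r * Polynomial.X + Polynomial.C c) with hq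
    have hlin : (Polynomial.C r * Polynomial.X + Polynomial.C c).natDegree = 1 :=
      Polynomial.natDegree_linear hr.ne'
    have hdeg : (p.comp (Polynomial.C r * Polynomial.X + Polynomial.C c)).natDegree = p.natDegree := by
      rw [Polynomial.natDegree_comp, hlin, mul_one]
    have hcoeff : (p.comp (Polynomial.C r * Polynomial.X + Polynomial.C c)).coeff e = p.coeff e * r ^ e := by
      rcases hp.lt_or_eq with h1 | h1
      · rw [Polynomial.coeff_eq_zero_of_natDegree_lt h1,
          Polynomial.coeff_eq_zero_of_natDegree_lt (by rw [hdeg]; exact h1), zero_mul]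
      · have := Polynomial.leadingCoeff_comp (p := p) (q := Polynomial.C r * Polynomial.X + Polynomial.C c)
          (by rw [hlin]; norm_num)
        rw [Polynomial.leadingCoeff, hdeg, Polynomial.leadingCoeff_linear hr.ne', Polynomial.leadingCoeff, h1] at this
        exact this
    have hqd : q.degree ≤ e := by
      apply Polynomial.degree_le_of_natDegree_le
      refine (Polynomial.natDegree_C_mul_le _ _).trans ?_
      rw [hdeg]; exact hp
    have hb := Polynomial.Chebyshev.coeff_le_of_forall_abs_le_one hqd (by
      intro x hx
      have h2 := h (r * x + c) ⟨by nlinarith [hx.1], by nlinarith [hx.2]⟩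
      simp only [hq, Polynomial.eval_mul, Polynomial.eval_C, Polynomial.eval_comp, Polynomial.eval_add,
        Polynomial.eval_X, abs_mul, hs, abs_inv, abs_of_pos hM]
      rw [one_mul, inv_mul_le_iff₀ hM, mul_one]
      exact h2)
    rw [hq, Polynomial.coeff_C_mul, hcoeff] at hb
    have h3 : (2:ℝ) ^ (e - 1) ≤ 2 ^ e := pow_le_pow_right₀ (by norm_num) (by omega)
    have h4 : s * M⁻¹ * (p.coeff e * r ^ e) ≤ 2 ^ e := hb.trans h3
    calc s * (p.coeff e * r ^ e) = (s * M⁻¹ * (p.coeff e * r ^ e)) * M := by field_simp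
      _ ≤ 2 ^ e * M := by gcongr
  rcases abs_cases (p.coeff e) with ⟨h1, _⟩ | ⟨h1, _⟩
  · rw [h1]; simpa using key 1 (by simp)
  · rw [h1]; simpa using key (-1) (by simp)

theorem loj_one (p : Polynomial ℝ) (e : ℕ) (hp : p.natDegree ≤ e) (x δ : ℝ) (hδ : 0 ≤ δ)
    (h0 : ∀ t, |t - x| < δ → p.eval t ≠ 0)
    (h1 : e ≠ 0 → ∀ t, |t - x| < δ → p.derivative.eval t ≠ 0) :
    |p.coeff e| * δ ^ e ≤ 4 ^ e * |p.eval x| := by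
  rcases Nat.eq_zero_or_pos e with rfl | he
  · rw [Polynomial.eq_C_of_natDegree_le_zero hp]; simp
  rcases hδ.eq_or_lt with rfl | hδ
  · rw [zero_pow he.ne']; simp
  have h1 := h1 he.ne'
  have hx : 0 < |p.eval x| := abs_pos.mpr (h0 x (by simpa using hδ))
  suffices H : ∃ c, ∀ t ∈ Set.Icc (c - δ / 2) (c + δ / 2), |p.eval t| ≤ |p.eval x| by
    obtain ⟨c, hc⟩ := H
    have := loj_cheb p e hp c (δ / 2) _ (by positivity) hx hc
    rw [div_pow, mul_div_assoc', div_le_iff₀ (by positivity)] at this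
    calc |p.coeff e| * δ ^ e ≤ _ := this
      _ = (2 * 2) ^ e * |p.eval x| := by rw [mul_pow]; ring
      _ = _ := by norm_num
  set g : Polynomial ℝ := p ^ 2 with hg
  have hgd : ∀ t, |t - x| < δ → g.derivative.eval t ≠ 0 := by
    intro t ht
    have := h0 t ht
    have := h1 t ht
    simp [Polynomial.derivative_pow, *]
  have hball : ∀ t, t ∈ Set.Ioo (x - δ) (x + δ) → |t - x| < δ := by
    intro t ht; rw [abs_lt]; constructor <;> linarith [ht.1, ht.2]
  have hsign : (∀ t ∈ Set.Ioo (x - δ) (x + δ), 0 < g.derivative.eval t) ∨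
      (∀ t ∈ Set.Ioo (x - δ) (x + δ), g.derivative.eval t < 0) := by
    by_contra! hcon
    obtain ⟨⟨a, ha, ha'⟩, ⟨b, hb, hb'⟩⟩ := hcon
    obtain ⟨z, hz, hz'⟩ := isPreconnected_Ioo.intermediate_value₂ (s := Set.Ioo (x - δ) (x + δ))
      ha hb (f := fun t => g.derivative.eval t)
      (g := fun _ => 0) (by fun_prop) (by fun_prop) ha' hb'
    exact hgd z (hball z hz) hz'
  have habs : ∀ t, g.eval t ≤ g.eval x → |p.eval t| ≤ |p.eval x| := by
    intro t ht
    simp only [hg, Polynomial.eval_pow] at ht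
    exact sq_le_sq.mp ht
  rcases hsign with hs | hs
  · have hm : MonotoneOn (fun t => g.eval t) (Set.Icc (x - δ) (x + δ)) := by
      refine monotoneOn_of_deriv_nonneg (convex_Icc _ _) (by fun_prop) (by fun_prop) ?_
      intro t ht
      rw [interior_Icc] at ht
      rw [Polynomial.deriv]
      exact (hs t ht).le
    refine ⟨x - δ / 2, fun t ht => habs t ?_⟩
    exact hm ⟨by linarith [ht.1], by linarith [ht.2]⟩ ⟨by linarith, by linarith⟩ (by linarith [ht.2])
  · have hm : AntitoneOn (fun t => g.eval t) (Set.Icc (x - δ) (x + δ)) := by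
      refine antitoneOn_of_deriv_nonpos (convex_Icc _ _) (by fun_prop) (by fun_prop) ?_
      intro t ht
      rw [interior_Icc] at ht
      rw [Polynomial.deriv]
      exact (hs t ht).le
    refine ⟨x + δ / 2, fun t ht => habs t ?_⟩
    exact hm ⟨by linarith, by linarith⟩ ⟨by linarith [ht.1], by linarith [ht.2]⟩ (by linarith [ht.1])

/-- Restriction of a polynomial to the line through `x` in direction `i`. -/
noncomputable def lojSlice {n : ℕ} (i : Fin n) (x : Fin n → ℝ) :
    MvPolynomial (Fin n) ℝ →ₐ[ℝ] Polynomial ℝ :=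
  MvPolynomial.aeval (fun j => if j = i then Polynomial.X else Polynomial.C (x j))

theorem lojSlice_eval {n : ℕ} (i : Fin n) (x : Fin n → ℝ) (Q : MvPolynomial (Fin n) ℝ) (t : ℝ) :
    (lojSlice i x Q).eval t = eval (Function.update x i t) Q := by
  unfold lojSlice
  induction Q using MvPolynomial.induction_on with
  | C a => simp
  | add p q hp hq => simp [hp, hq]
  | mul_X p j hp =>
    simp only [map_mul, Polynomial.eval_mul, hp, aeval_X, eval_X]
    by_cases h : j = i
    · subst h; simp
    · simp [h]

theorem lojSlice_deriv {n : ℕ} (i : Fin n) (x : Fin n → ℝ) (Q : MvPolynomial (Fin n) ℝ) :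
    Polynomial.derivative (lojSlice i x Q) = lojSlice i x (pderiv i Q) := by
  unfold lojSlice
  induction Q using MvPolynomial.induction_on with
  | C a => simp
  | add p q hp hq => simp [hp, hq]
  | mul_X p j hp =>
    simp only [map_mul, Polynomial.derivative_mul, hp, aeval_X, pderiv_mul, map_add]
    by_cases h : j = i
    · subst h; simp
    · simp [h]

theorem lojSlice_monomial {n : ℕ} (i : Fin n) (x : Fin n → ℝ) (β : Fin n →₀ ℕ) (a : ℝ) :
    lojSlice i x (monomial β a) =
      Polynomial.C (eval x (monomial (β.erase i) a)) * Polynomial.X ^ (β i) := by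
  have h1 : monomial β a = monomial (β.erase i) a * (X i : MvPolynomial (Fin n) ℝ) ^ (β i) := by
    rw [X_pow_eq_monomial, monomial_mul, mul_one, Finsupp.erase_add_single]
  rw [h1, map_mul, map_pow]
  congr 1
  · simp only [lojSlice, aeval_monomial, eval_monomial, Finsupp.prod, map_mul, map_prod, map_pow]
    congr 1
    refine Finset.prod_congr rfl fun j hj => ?_
    have : j ≠ i := by rintro rfl; simp at hj
    simp [this]
  · simp [lojSlice]

/-- The coefficient of `x_i ^ e`. -/
noncomputable def lojTop {n : ℕ} (i : Fin n) (e : ℕ) (Q : MvPolynomial (Fin n) ℝ) :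
    MvPolynomial (Fin n) ℝ :=
  ∑ β ∈ Q.support with β i = e, monomial (β.erase i) (coeff β Q)

theorem lojSlice_coeff {n : ℕ} (i : Fin n) (x : Fin n → ℝ) (e : ℕ) (Q : MvPolynomial (Fin n) ℝ) :
    (lojSlice i x Q).coeff e = eval x (lojTop i e Q) := by
  conv_lhs => rw [Q.as_sum]
  rw [map_sum, Polynomial.finsetSum_coeff, lojTop, map_sum, Finset.sum_filter]
  refine Finset.sum_congr rfl fun β _ => ?_
  rw [lojSlice_monomial, Polynomial.coeff_C_mul, Polynomial.coeff_X_pow]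
  by_cases h : β i = e
  · simp [h]
  · simp [h, Ne.symm h]

theorem lojSlice_natDegree {n : ℕ} (i : Fin n) (x : Fin n → ℝ) (e : ℕ) (Q : MvPolynomial (Fin n) ℝ)
    (h : ∀ β, coeff β Q ≠ 0 → β i ≤ e) : (lojSlice i x Q).natDegree ≤ e := by
  rw [Q.as_sum, map_sum]
  refine Polynomial.natDegree_sum_le_of_forall_le _ _ fun β hβ => ?_
  rw [lojSlice_monomial]
  exact (Polynomial.natDegree_C_mul_X_pow_le _ _).trans (h β (mem_support_iff.mp hβ))

theorem lojTop_coeff {n : ℕ} (i : Fin n) (Q : MvPolynomial (Fin n) ℝ) (γ : Fin n →₀ ℕ)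
    (hγ : coeff γ Q ≠ 0) : coeff (γ.erase i) (lojTop i (γ i) Q) = coeff γ Q := by
  rw [lojTop, coeff_sum, Finset.sum_eq_single γ]
  · simp
  · intro β hβ hne
    rw [coeff_monomial, if_neg]
    intro h
    apply hne
    have h2 := (Finset.mem_filter.mp hβ).2
    rw [← Finsupp.erase_add_single i β, ← Finsupp.erase_add_single i γ, h, h2]
  · intro h
    exact (h (by simp [hγ])).elim

theorem lojTop_support {n : ℕ} (i : Fin n) (e : ℕ) (Q : MvPolynomial (Fin n) ℝ) (β : Fin n →₀ ℕ)
    (hβ : coeff β (lojTop i e Q) ≠ 0) : ∃ β', coeff β' Q ≠ 0 ∧ β' i = e ∧ β = β'.erase i := by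
  rw [lojTop, coeff_sum] at hβ
  obtain ⟨β', h1, h2⟩ := Finset.exists_ne_zero_of_sum_ne_zero hβ
  rw [Finset.mem_filter, mem_support_iff] at h1
  refine ⟨β', h1.1, h1.2, ?_⟩
  rw [coeff_monomial] at h2
  by_contra h
  rw [if_neg (Ne.symm h)] at h2
  exact h2 rfl

/-- Lexicographic order along a list of variables. -/
def lojLex {n : ℕ} : List (Fin n) → (Fin n →₀ ℕ) → (Fin n →₀ ℕ) → Prop
  | [], _, _ => False
  | i :: l, β, γ => β i < γ i ∨ (β i = γ i ∧ lojLex l β γ)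

theorem lojLex_erase {n : ℕ} (i : Fin n) (l : List (Fin n)) (β γ : Fin n →₀ ℕ) (h : β i = γ i)
    (hl : lojLex l β γ) : lojLex l (β.erase i) (γ.erase i) := by
  induction l with
  | nil => exact hl
  | cons j l ih =>
    by_cases hj : j = i
    · subst hj
      rcases hl with hl | ⟨_, hl⟩
      · omega
      · exact Or.inr ⟨by simp, ih hl⟩
    · simp only [lojLex, Finsupp.erase_ne hj] at hl ⊢
      exact hl.imp id (fun h => ⟨h.1, ih h.2⟩)

theorem lojLex_ofFn {n m : ℕ} (f : Fin m → Fin n) (β γ : Fin n →₀ ℕ)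
    (h : ∃ j : Fin m, β (f j) < γ (f j) ∧ ∀ k : Fin m, k < j → γ (f k) = β (f k)) :
    lojLex (List.ofFn f) β γ := by
  induction m with
  | zero => obtain ⟨j, _⟩ := h; exact j.elim0
  | succ m ih =>
    rw [List.ofFn_succ]
    obtain ⟨j, hj, hk⟩ := h
    induction j using Fin.cases with
    | zero => exact Or.inl hj
    | succ j =>
      exact Or.inr ⟨(hk 0 (Fin.succ_pos j)).symm, ih (fun k => f k.succ)
        ⟨j, hj, fun k hkj => hk k.succ (Fin.succ_lt_succ_iff.mpr hkj)⟩⟩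

theorem loj_sum_erase {n : ℕ} (i : Fin n) (γ : Fin n →₀ ℕ) :
    ∑ j, γ j = γ i + ∑ j, (γ.erase i) j := by
  conv_lhs => rw [← Finsupp.erase_add_single i γ]
  simp only [Finsupp.add_apply, Finset.sum_add_distrib]
  rw [add_comm]
  congr 1
  simp [Finsupp.single_apply]

theorem loj_dist_update {n : ℕ} (x : EuclideanSpace ℝ (Fin n)) (i : Fin n) (t : ℝ) :
    dist (WithLp.toLp 2 (Function.update (fun j => x j) i t) : EuclideanSpace ℝ (Fin n)) x
      = |t - x i| := by
  rw [EuclideanSpace.dist_eq, Finset.sum_eq_single i]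
  · rw [Real.sqrt_sq dist_nonneg]
    simp [Real.dist_eq]
  · intro j _ hj
    simp [hj]
  · simp

theorem loj_main {n : ℕ} (l : List (Fin n)) : ∀ (Q : MvPolynomial (Fin n) ℝ) (γ : Fin n →₀ ℕ),
    coeff γ Q ≠ 0 → (∀ β, β ≠ γ → coeff β Q ≠ 0 → lojLex l β γ) → (∀ j, j ∉ l → γ j = 0) →
    ∃ s : Finset (MvPolynomial (Fin n) ℝ), (∀ q ∈ s, q ≠ 0) ∧
      ∀ (x : EuclideanSpace ℝ (Fin n)) (δ : ℝ), 0 ≤ δ →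
        (∀ q ∈ s, ∀ y : EuclideanSpace ℝ (Fin n), dist y x < δ → eval (fun i => y i) q ≠ 0) →
        |coeff γ Q| * δ ^ (∑ i, γ i) ≤ 4 ^ (∑ i, γ i) * |eval (fun i => x i) Q| := by
  classical
  induction l with
  | nil =>
    intro Q γ hγ hlex hl
    have hγ0 : γ = 0 := Finsupp.ext fun j => hl j (by simp)
    subst hγ0
    have hQ : Q = C (coeff 0 Q) := by
      ext β
      rw [coeff_C]
      split_ifs with h
      · rw [h]
      · by_contra h2
        exact hlex β (Ne.symm h) h2
    refine ⟨∅, by simp, fun x δ _ _ => ?_⟩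
    conv_rhs => rw [hQ]
    simp
  | cons i l ih =>
    intro Q γ hγ hlex hl
    have htop := lojTop_coeff i Q γ hγ
    obtain ⟨s, hs, hs'⟩ := ih (lojTop i (γ i) Q) (γ.erase i) (by rw [htop]; exact hγ) (by
      intro β hne hβ
      obtain ⟨β', h1, h2, rfl⟩ := lojTop_support i _ Q β hβ
      refine lojLex_erase i l _ _ h2 ?_
      rcases hlex β' (by rintro rfl; exact hne rfl) h1 with h | h
      · omega
      · exact h.2) (by
      intro j hj
      by_cases hji : j = i
      · subst hji; simp
      · rw [Finsupp.erase_ne hji]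
        exact hl j (by simp [hji, hj]))
    refine ⟨insert Q (s ∪ if γ i = 0 then ∅ else {pderiv i Q}), ?_, ?_⟩
    · intro q hq
      rw [Finset.mem_insert, Finset.mem_union] at hq
      rcases hq with rfl | hq | hq
      · rintro rfl; simp at hγ
      · exact hs q hq
      · split_ifs at hq with h
        · simp at hq
        · rw [Finset.mem_singleton] at hq
          subst hq
          intro h0
          have h1 := coeff_pderiv (i := i) Q (γ - Finsupp.single i 1)
          rw [h0, coeff_zero, tsub_add_cancel_of_le (by simp; omega)] at h1
          rcases mul_eq_zero.mp h1.symm with h2 | h2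
          · exact hγ h2
          · exact (Nat.cast_add_one_ne_zero _) h2
    · intro x δ hδ hball
      have hA := hs' x δ hδ (fun q hq => hball q (by simp [hq]))
      have hB := loj_one (lojSlice i (fun j => x j) Q) (γ i) (lojSlice_natDegree i _ _ Q (by
          intro β hβ
          by_cases h : β = γ
          · rw [h]
          · rcases hlex β h hβ with h | h
            · exact h.le
            · exact h.1.le)) (x i) δ hδ (by
          intro t ht
          rw [lojSlice_eval]
          exact hball Q (by simp) (WithLp.toLp 2 (Function.update (fun j => x j) i t))
            (by rw [loj_dist_update]; exact ht)) (by
          intro he t ht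
          rw [lojSlice_deriv, lojSlice_eval]
          exact hball _ (by simp [he]) (WithLp.toLp 2 (Function.update (fun j => x j) i t))
            (by rw [loj_dist_update]; exact ht))
      rw [lojSlice_coeff, lojSlice_eval, Function.update_eq_self i (fun j => x j)] at hB
      rw [htop] at hA
      rw [loj_sum_erase i γ, pow_add, pow_add]
      set D := ∑ j, (γ.erase i) j
      calc |coeff γ Q| * (δ ^ γ i * δ ^ D) = (|coeff γ Q| * δ ^ D) * δ ^ γ i := by ring
        _ ≤ (4 ^ D * |eval (fun j => x j) (lojTop i (γ i) Q)|) * δ ^ γ i := by gcongr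
        _ = 4 ^ D * (|eval (fun j => x j) (lojTop i (γ i) Q)| * δ ^ γ i) := by ring
        _ ≤ 4 ^ D * (4 ^ γ i * |eval (fun j => x j) Q|) := by gcongr
        _ = _ := by ring

theorem loj_hasStrictFDerivAt {n : ℕ} (P : MvPolynomial (Fin n) ℝ) (x : EuclideanSpace ℝ (Fin n)) :
    HasStrictFDerivAt (fun y : EuclideanSpace ℝ (Fin n) => eval (fun i => y i) P)
      (∑ i, eval (fun i => x i) (pderiv i P) •
        (EuclideanSpace.proj i : EuclideanSpace ℝ (Fin n) →L[ℝ] ℝ)) x := by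
  induction P using MvPolynomial.induction_on with
  | C a => simpa using hasStrictFDerivAt_const a x
  | add p q hp hq =>
    simp only [map_add, add_smul, Finset.sum_add_distrib]
    exact hp.add hq
  | mul_X p j hp =>
    have hj : HasStrictFDerivAt (fun y : EuclideanSpace ℝ (Fin n) => y j)
        (EuclideanSpace.proj j : EuclideanSpace ℝ (Fin n) →L[ℝ] ℝ) x :=
      (EuclideanSpace.proj j : EuclideanSpace ℝ (Fin n) →L[ℝ] ℝ).hasStrictFDerivAt
    simp only [map_mul, eval_X]
    refine (hp.mul hj).congr_fderiv ?_
    ext v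
    simp only [pderiv_mul, map_add, map_mul, eval_X, pderiv_X, _root_.add_apply,
      _root_.smul_apply, _root_.sum_apply, smul_eq_mul,
      Finset.sum_add_distrib, add_mul, Finset.mul_sum]
    rw [add_comm]
    congr 1
    · exact Finset.sum_congr rfl fun i _ => by ring
    · rw [Finset.sum_eq_single j]
      · simp
      · intro i _ hi
        simp [Ne.symm hi]
      · simp

theorem loj_norm_le_sum {n : ℕ} (u : EuclideanSpace ℝ (Fin n)) : ‖u‖ ≤ ∑ i, |u i| := by
  conv_lhs => rw [← (EuclideanSpace.basisFun (Fin n) ℝ).sum_repr u]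
  refine (norm_sum_le _ _).trans (Finset.sum_le_sum fun i _ => ?_)
  simp [norm_smul]

/-- Forget the `i`-th coordinate. -/
def lojForget {n : ℕ} (i : Fin n) (x : EuclideanSpace ℝ (Fin n)) : {j : Fin n // j ≠ i} → ℝ :=
  fun j => x j

theorem loj_dimH_univ {n : ℕ} (i : Fin n) :
    dimH (Set.univ : Set ({j : Fin n // j ≠ i} → ℝ)) = ((n - 1 : ℕ) : ℝ≥0∞) := by
  rw [Real.dimH_univ_pi]
  simp [Fintype.card_subtype_compl]

theorem loj_dimH_le_of_antilip {n : ℕ} (i : Fin n) (t : Set (EuclideanSpace ℝ (Fin n))) (K : ℝ≥0)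
    (h : ∀ x ∈ t, ∀ y ∈ t, dist x y ≤ K * dist (lojForget i x) (lojForget i y)) :
    dimH t ≤ ((n - 1 : ℕ) : ℝ≥0∞) := by
  have hA : AntilipschitzWith K (fun x : t => lojForget i x.1) :=
    AntilipschitzWith.of_le_mul_dist fun x y => h x x.2 y y.2
  have h1 := hA.le_dimH_image Set.univ
  have h2 : dimH (Set.univ : Set t) = dimH t := by
    have := (isometry_subtype_coe (s := t)).dimH_image Set.univ
    rw [← this]; simp
  rw [← h2, ← loj_dimH_univ i]
  exact h1.trans (dimH_mono (Set.subset_univ _))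

theorem loj_dimH_regular {n : ℕ} (P : MvPolynomial (Fin n) ℝ) (i : Fin n) :
    dimH {x : EuclideanSpace ℝ (Fin n) | eval (fun i => x i) P = 0 ∧
      eval (fun i => x i) (pderiv i P) ≠ 0} ≤ ((n - 1 : ℕ) : ℝ≥0∞) := by
  by_contra! hcon
  obtain ⟨x, hx, hxt⟩ := exists_mem_nhdsWithin_lt_dimH_of_lt_dimH hcon
  set S := {x : EuclideanSpace ℝ (Fin n) | eval (fun i => x i) P = 0 ∧
      eval (fun i => x i) (pderiv i P) ≠ 0}
  obtain ⟨hx0, hx1⟩ := hx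
  have hd := (loj_hasStrictFDerivAt P x).isLittleO
  obtain ⟨c, hc⟩ : ∃ c : Fin n → ℝ, ∀ j, eval (fun i => x i) (pderiv j P) = c j := ⟨_, fun _ => rfl⟩
  simp only [hc] at hd
  have hci : 0 < |c i| := abs_pos.mpr (by rw [← hc]; exact hx1)
  have hev := hd.def (c := |c i| / 2) (by positivity)
  rw [nhds_prod_eq] at hev
  obtain ⟨U, hU, hUU⟩ := Filter.eventually_prod_self_iff'.mp hev
  obtain ⟨B, hB⟩ : ∃ B : ℝ, B = ∑ j, |c j| := ⟨_, rfl⟩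
  have hB0 : 0 ≤ B := hB ▸ Finset.sum_nonneg fun _ _ => abs_nonneg _
  have hK : 0 ≤ 2 * B / |c i| + 2 * (n : ℝ) := by positivity
  refine (hxt (U ∩ S) (Filter.inter_mem (mem_nhdsWithin_of_mem_nhds hU) self_mem_nhdsWithin)).not_ge ?_
  refine loj_dimH_le_of_antilip i _ (Real.toNNReal (2 * B / |c i| + 2 * n)) ?_
  intro y hy z hz
  rw [Real.coe_toNNReal _ hK]
  obtain ⟨D, hD⟩ : ∃ D, D = dist (lojForget i y) (lojForget i z) := ⟨_, rfl⟩
  have hD0 : 0 ≤ D := hD ▸ dist_nonneg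
  rw [← hD]
  have h1 := hUU y hy.1 z hz.1
  simp only [hy.2.1, hz.2.1] at h1
  set u := y - z with hu
  have huj : ∀ j, j ≠ i → |u j| ≤ D := by
    intro j hj
    have := dist_le_pi_dist (lojForget i y) (lojForget i z) ⟨j, hj⟩
    rw [Real.dist_eq, ← hD] at this
    simpa [lojForget, hu] using this
  have hLu : (∑ j, c j • (EuclideanSpace.proj j : EuclideanSpace ℝ (Fin n) →L[ℝ] ℝ)) u
      = c i * u i + ∑ j ∈ Finset.univ.erase i, c j * u j := by
    rw [Finset.add_sum_erase _ (fun j => c j * u j) (Finset.mem_univ i)]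
    simp
  have hrest : |∑ j ∈ Finset.univ.erase i, c j * u j| ≤ B * D := by
    calc _ ≤ ∑ j ∈ Finset.univ.erase i, |c j * u j| := Finset.abs_sum_le_sum_abs _ _
      _ ≤ ∑ j ∈ Finset.univ.erase i, |c j| * D := by
          refine Finset.sum_le_sum fun j hj => ?_
          rw [abs_mul]
          exact mul_le_mul_of_nonneg_left (huj j (Finset.ne_of_mem_erase hj)) (abs_nonneg _)
      _ ≤ ∑ j, |c j| * D := Finset.sum_le_sum_of_subset_of_nonneg (Finset.erase_subset _ _)
          fun _ _ _ => by positivity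
      _ = B * D := by rw [hB, Finset.sum_mul]
  have hnorm : ‖u‖ ≤ |u i| + n * D := by
    refine (loj_norm_le_sum u).trans ?_
    rw [← Finset.add_sum_erase _ (fun j => |u j|) (Finset.mem_univ i)]
    gcongr
    calc _ ≤ ∑ j ∈ Finset.univ.erase i, D := Finset.sum_le_sum fun j hj => huj j (Finset.ne_of_mem_erase hj)
      _ ≤ ∑ j : Fin n, D := Finset.sum_le_sum_of_subset_of_nonneg (Finset.erase_subset _ _)
          fun _ _ _ => hD0
      _ = n * D := by simp
  have h2 : |c i * u i + ∑ j ∈ Finset.univ.erase i, c j * u j| ≤ |c i| / 2 * ‖u‖ := by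
    rw [← hLu]
    simpa using h1
  have h3 : |c i| * |u i| ≤ |c i| / 2 * (|u i| + n * D) + B * D := by
    rw [← abs_mul]
    have h4 := abs_sub_abs_le_abs_sub (c i * u i) (-(∑ j ∈ Finset.univ.erase i, c j * u j))
    rw [abs_neg, sub_neg_eq_add] at h4
    have h5 : |c i| / 2 * ‖u‖ ≤ |c i| / 2 * (|u i| + n * D) := by gcongr
    linarith
  have h6 : |u i| ≤ 2 * B / |c i| * D + n * D := by
    have : |c i| * |u i| ≤ |c i| * (2 * B / |c i| * D + n * D) := by
      have e : |c i| * (2 * B / |c i| * D + n * D) = 2 * B * D + |c i| * (n * D) := by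
        field_simp
      rw [e]; linarith
    exact le_of_mul_le_mul_left this hci
  rw [dist_eq_norm]
  calc ‖u‖ ≤ _ := hnorm
    _ ≤ (2 * B / |c i| * D + n * D) + n * D := by gcongr
    _ = _ := by ring

theorem loj_dimH_zero {n : ℕ} (d : ℕ) : ∀ (P : MvPolynomial (Fin n) ℝ), P ≠ 0 → P.totalDegree ≤ d →
    dimH {x : EuclideanSpace ℝ (Fin n) | eval (fun i => x i) P = 0} ≤ ((n - 1 : ℕ) : ℝ≥0∞) := by
  induction d with
  | zero =>
    intro P hP hd
    have h := totalDegree_eq_zero_iff_eq_C.mp (Nat.le_zero.mp hd)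
    have hc : coeff 0 P ≠ 0 := by
      intro h0; apply hP; rw [h, h0, C_0]
    have : {x : EuclideanSpace ℝ (Fin n) | eval (fun i => x i) P = 0} = ∅ := by
      ext x
      rw [h]
      simpa using hc
    rw [this]; simp
  | succ d ih =>
    intro P hP hd
    by_cases hz : ∀ i, pderiv i P = 0
    · apply ih P hP
      refine Finset.sup_le ?_
      intro m hm
      by_cases hm0 : m = 0
      · simp [hm0]
      · exfalso
        obtain ⟨i, hi⟩ := Finsupp.ne_iff.mp hm0
        have h1 := coeff_pderiv (i := i) P (m - Finsupp.single i 1)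
        rw [hz i, coeff_zero, tsub_add_cancel_of_le (by simpa [Nat.one_le_iff_ne_zero] using hi)] at h1
        rcases mul_eq_zero.mp h1.symm with h2 | h2
        · exact mem_support_iff.mp hm h2
        · exact (Nat.cast_add_one_ne_zero _) h2
    · push Not at hz
      obtain ⟨i, hi⟩ := hz
      have h2 := ih (pderiv i P) hi (by
        refine Finset.sup_le ?_
        intro m hm
        have h3 : m + Finsupp.single i 1 ∈ P.support := by
          rw [mem_support_iff] at hm ⊢
          rw [coeff_pderiv] at hm
          exact left_ne_zero_of_mul hm
        have h4 := (le_totalDegree h3).trans hd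
        rw [Finsupp.sum_add_index' (by simp) (by simp), Finsupp.sum_single_index rfl] at h4
        omega)
      refine (dimH_mono (t := {x : EuclideanSpace ℝ (Fin n) | eval (fun i => x i) P = 0 ∧
        eval (fun i => x i) (pderiv i P) ≠ 0} ∪
        {x : EuclideanSpace ℝ (Fin n) | eval (fun i => x i) (pderiv i P) = 0}) ?_).trans ?_
      · intro x hx
        by_cases h : eval (fun i => x i) (pderiv i P) = 0
        · exact Or.inr h
        · exact Or.inl ⟨hx, h⟩
      · rw [dimH_union]
        exact max_le (loj_dimH_regular P i) h2

theorem loj_dimH_hyperplane {n : ℕ} (i : Fin n) :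
    ((n - 1 : ℕ) : ℝ≥0∞) ≤ dimH {x : EuclideanSpace ℝ (Fin n) | x i = 0} := by
  have hL : LipschitzWith 1 (lojForget i) := by
    refine LipschitzWith.of_dist_le_mul fun x y => ?_
    rw [NNReal.coe_one, one_mul, dist_pi_le_iff dist_nonneg]
    intro j
    rw [dist_eq_norm x y]
    exact (PiLp.norm_apply_le (x - y) j.1)
  rw [← loj_dimH_univ i]
  refine le_trans (dimH_mono ?_) (hL.dimH_image_le {x : EuclideanSpace ℝ (Fin n) | x i = 0})
  intro v _
  refine ⟨WithLp.toLp 2 (fun j => if h : j ≠ i then v ⟨j, h⟩ else 0), by simp, ?_⟩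
  funext j
  simp [lojForget, j.2]

theorem statement4 (n : ℕ) (P : MvPolynomial (Fin n) ℝ) (α : Fin n →₀ ℕ)
    (hα : IsAdmissibleIndex P α) :
    ∃ Zα : Set (EuclideanSpace ℝ (Fin n)),
      (∃ s : Finset (MvPolynomial (Fin n) ℝ),
          Zα = ⋃ Q ∈ s, {x : EuclideanSpace ℝ (Fin n) | eval (fun i => x i) Q = 0}) ∧
      dimH ({x : EuclideanSpace ℝ (Fin n) | eval (fun i => x i) P = 0} ∪ Zα) =
        ((n - 1 : ℕ) : ℝ≥0∞) ∧
      ∀ x : EuclideanSpace ℝ (Fin n),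
        infDist x ({y : EuclideanSpace ℝ (Fin n) | eval (fun i => y i) P = 0} ∪ Zα) ≤
          4 / |coeff α P| ^ ((1 : ℝ) / (∑ i, α i : ℝ)) *
            |eval (fun i => x i) P| ^ ((1 : ℝ) / (∑ i, α i : ℝ)) := by
  classical
  obtain ⟨hc, σ, ⟨hn, hα0⟩, hlex⟩ := hα
  set i₀ := σ ⟨0, hn⟩ with hi₀
  obtain ⟨s, hs, hmain⟩ := loj_main (List.ofFn σ) P α hc
    (fun β hne hβ => lojLex_ofFn σ β α (hlex β hne hβ))
    (fun j hj => (hj (by rw [List.mem_ofFn]; exact σ.surjective j)).elim)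
  have hP : P ≠ 0 := by rintro rfl; simp at hc
  refine ⟨_, ⟨insert (X i₀) s, rfl⟩, le_antisymm ?_ ?_, ?_⟩
  · rw [dimH_union]
    refine max_le (loj_dimH_zero _ P hP le_rfl) ?_
    have := dimH_bUnion (s := ((insert (X i₀) s : Finset (MvPolynomial (Fin n) ℝ)) : Set _))
      (Finset.countable_toSet _)
      (fun Q => {x : EuclideanSpace ℝ (Fin n) | eval (fun i => x i) Q = 0})
    simp only [Finset.mem_coe] at this
    rw [this]
    refine iSup₂_le fun Q hQ => loj_dimH_zero _ Q ?_ le_rfl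
    rcases Finset.mem_insert.mp hQ with rfl | hQ
    · exact X_ne_zero _
    · exact hs Q hQ
  · refine (loj_dimH_hyperplane i₀).trans (dimH_mono ?_)
    intro x hx
    refine Or.inr (Set.mem_biUnion (Finset.mem_insert_self _ _) ?_)
    simpa using hx
  · intro x
    set A := {y : EuclideanSpace ℝ (Fin n) | eval (fun i => y i) P = 0} ∪
      ⋃ Q ∈ insert (X i₀) s, {x : EuclideanSpace ℝ (Fin n) | eval (fun i => x i) Q = 0}
    have h1 := hmain x (infDist x A) infDist_nonneg (by
      intro q hq y hy h0
      rw [dist_comm] at hy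
      refine notMem_of_dist_lt_infDist hy (Or.inr (Set.mem_biUnion (Finset.mem_insert_of_mem hq) h0)))
    set N := ∑ i, α i with hN
    have hNpos : N ≠ 0 := by
      have : α i₀ ≤ N := Finset.single_le_sum (f := fun i => α i) (fun _ _ => Nat.zero_le _)
        (Finset.mem_univ i₀)
      omega
    have hcast : (∑ i, (α i : ℝ)) = (N : ℝ) := by rw [hN]; push_cast; rfl
    rw [hcast]
    have ha : 0 < |coeff α P| := abs_pos.mpr hc
    have h2 : infDist x A ^ N ≤ 4 ^ N * (|eval (fun i => x i) P| / |coeff α P|) := by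
      rw [mul_div_assoc', le_div_iff₀ ha, mul_comm]; exact h1
    have h3 := Real.rpow_le_rpow (pow_nonneg infDist_nonneg N) h2 (z := 1 / (N : ℝ)) (by positivity)
    rw [one_div, Real.pow_rpow_inv_natCast infDist_nonneg hNpos,
      Real.mul_rpow (by positivity) (by positivity),
      Real.pow_rpow_inv_natCast (by norm_num) hNpos, Real.div_rpow (abs_nonneg _) (abs_nonneg _)] at h3
    rw [one_div]
    calc _ ≤ _ := h3
      _ = _ := by ring
end

section
/- Let S_1, …, S_k be real algebraic sets in ℝ^n (each the zero set of finitely many real polynomials) which are separated at infinity, and set S := S_1 ∩ ⋯ ∩ S_k. Then there exist positive constants θ, C, δ such that C·d(x, S)^θ ≤ d(x, S_1) + ⋯ + d(x, S_k) for every x ∈ ℝ^n with max{d(x, S_1), …, d(x, S_k)} < δ. -/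
open MeasureTheory Metric MvPolynomial Filter
open scoped ENNReal NNReal

/-- A collection `S_1, …, S_k` of (closed) subsets of `ℝ^n` is *separated at infinity* if
`S := S_1 ∩ ⋯ ∩ S_k ≠ ∅` and for all sequences `a_{j,l} ∈ S_j` with `‖a_{j,l}‖ → ∞` and
`‖a_{j,l} - a_{m,l}‖ → 0` for all `j < m`, one has `d(a_{j,l}, S) → 0` for each `j`. -/
def SeparatedAtInfinity {n k : ℕ} (S : Fin k → Set (EuclideanSpace ℝ (Fin n))) : Prop :=
  (⋂ j, S j).Nonempty ∧
  ∀ a : Fin k → ℕ → EuclideanSpace ℝ (Fin n),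
    (∀ j l, a j l ∈ S j) →
    (∀ j, Tendsto (fun l => ‖a j l‖) atTop atTop) →
    (∀ j m : Fin k, j < m → Tendsto (fun l => ‖a j l - a m l‖) atTop (nhds 0)) →
    ∀ j, Tendsto (fun l => infDist (a j l) (⋂ i, S i)) atTop (nhds 0)

namespace SAProof

/-- A Boolean algebra of predicates. -/
structure IsBA {α : Type*} (D : (α → Prop) → Prop) : Prop where
  tru : D fun _ => True
  not : ∀ {p}, D p → D fun a => ¬ p a
  and : ∀ {p q}, D p → D q → D fun a => p a ∧ q a

namespace IsBA
variable {α : Type*} {D : (α → Prop) → Prop}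

lemma fls (h : IsBA D) : D fun _ => False := by simpa using h.not h.tru

lemma or (h : IsBA D) {p q : α → Prop} (hp : D p) (hq : D q) : D fun a => p a ∨ q a := by
  have := h.not (h.and (h.not hp) (h.not hq))
  refine (congrArg D ?_).mp this
  funext a; apply propext; tauto

lemma imp (h : IsBA D) {p q : α → Prop} (hp : D p) (hq : D q) : D fun a => p a → q a := by
  have := h.or (h.not hp) hq
  refine (congrArg D ?_).mp this
  funext a; apply propext; tauto

lemma const (h : IsBA D) (p : Prop) : D fun _ => p := by
  by_cases hp : p
  · simpa [hp] using h.tru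
  · simpa [hp] using h.fls

lemma exi (h : IsBA D) {β : Type*} {L : Set β} (hL : L.Finite) {p : β → α → Prop}
    (hp : ∀ f ∈ L, D (p f)) : D fun a => ∃ f ∈ L, p f a := by
  induction L, hL using Set.Finite.induction_on with
  | empty => simpa using h.fls
  | @insert b s _ _ ih =>
    have := h.or (hp b (by simp)) (ih fun f hf => hp f (by simp [hf]))
    simpa using this

lemma all (h : IsBA D) {β : Type*} {L : Set β} (hL : L.Finite) {p : β → α → Prop}
    (hp : ∀ f ∈ L, D (p f)) : D fun a => ∀ f ∈ L, p f a := by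
  have := h.not (h.exi hL fun f hf => h.not (hp f hf))
  simpa using this

end IsBA

section real
open Polynomial

lemma pos_of_no_root {p : ℝ[X]} {x y : ℝ} (h : ∀ z, z ∈ Set.uIcc x y → p.eval z ≠ 0)
    (hx : 0 < p.eval x) : 0 < p.eval y := by
  by_contra hy
  push Not at hy
  have hc : ContinuousOn (fun z => p.eval z) (Set.uIcc x y) := p.continuous.continuousOn
  have := intermediate_value_uIcc hc
  obtain ⟨z, hz, hz0⟩ := this (show (0:ℝ) ∈ Set.uIcc (p.eval x) (p.eval y) by
    rw [Set.mem_uIcc]; right; exact ⟨hy, hx.le⟩)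
  exact h z hz hz0

lemma mono_aux {p : ℝ[X]} {u v : ℝ} (h : ∀ z ∈ Set.Ioo u v, p.derivative.eval z ≠ 0) (huv : u < v) :
    StrictMonoOn (fun x => p.eval x) (Set.Icc u v) ∨
      StrictAntiOn (fun x => p.eval x) (Set.Icc u v) := by
  have hm : (u + v) / 2 ∈ Set.Ioo u v := ⟨by linarith, by linarith⟩
  have hsub : ∀ x ∈ Set.Ioo u v, Set.uIcc ((u + v) / 2) x ⊆ Set.Ioo u v := fun x hx =>
    Set.OrdConnected.uIcc_subset Set.ordConnected_Ioo hm hx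
  rcases lt_or_gt_of_ne (h _ hm) with h0 | h0
  · right
    apply strictAntiOn_of_deriv_neg (convex_Icc u v) p.continuous.continuousOn
    intro x hx
    rw [interior_Icc] at hx
    have := pos_of_no_root (p := -p.derivative) (x := (u + v) / 2) (y := x)
      (fun z hz => by simpa using h z (hsub x hx hz)) (by simpa using h0)
    simpa using this
  · left
    apply strictMonoOn_of_deriv_pos (convex_Icc u v) p.continuous.continuousOn
    intro x hx
    rw [interior_Icc] at hx
    have := pos_of_no_root (p := p.derivative) (x := (u + v) / 2) (y := x)
      (fun z hz => by simpa using h z (hsub x hx hz)) (by simpa using h0)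
    simpa using this

/-- Unique root in an interval without critical points. -/
lemma root_exists {p : ℝ[X]} {u v : ℝ} (huv : u < v)
    (hs : p.eval u * p.eval v < 0) : ∃ x ∈ Set.Ioo u v, p.eval x = 0 := by
  have hc : ContinuousOn (fun z => p.eval z) (Set.Icc u v) := p.continuous.continuousOn
  rcases mul_neg_iff.mp hs with ⟨h1, h2⟩ | ⟨h1, h2⟩
  · obtain ⟨z, hz, h⟩ := intermediate_value_Ioo' huv.le hc ⟨h2, h1⟩
    exact ⟨z, hz, h⟩
  · obtain ⟨z, hz, h⟩ := intermediate_value_Ioo huv.le hc ⟨h1, h2⟩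
    exact ⟨z, hz, h⟩

lemma root_sign {p : ℝ[X]} {u v x : ℝ} (h : ∀ z ∈ Set.Ioo u v, p.derivative.eval z ≠ 0)
    (hx : x ∈ Set.Ioo u v) (hx0 : p.eval x = 0) :
    p.eval u * p.eval v < 0 ∧ ∀ z ∈ Set.Ioo u v, (z < x ↔ 0 < p.eval z * p.eval u) ∧
      (x < z ↔ p.eval z * p.eval u < 0) := by
  have huv : u < v := hx.1.trans hx.2
  have hu : u ∈ Set.Icc u v := ⟨le_rfl, huv.le⟩
  have hv : v ∈ Set.Icc u v := ⟨huv.le, le_rfl⟩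
  have hxI : x ∈ Set.Icc u v := ⟨hx.1.le, hx.2.le⟩
  rcases mono_aux h huv with hm | hm
  · have h1 : p.eval u < 0 := by simpa [hx0] using hm hu hxI hx.1
    have h2 : 0 < p.eval v := by simpa [hx0] using hm hxI hv hx.2
    refine ⟨mul_neg_of_neg_of_pos h1 h2, fun z hz => ?_⟩
    have hzI : z ∈ Set.Icc u v := ⟨hz.1.le, hz.2.le⟩
    have e1 := hm.lt_iff_lt hzI hxI
    have e2 := hm.lt_iff_lt hxI hzI
    simp only [hx0] at e1 e2
    rw [← e1, ← e2]
    constructor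
    · constructor
      · intro h; exact mul_pos_of_neg_of_neg h h1
      · intro h; by_contra hh; push Not at hh; nlinarith
    · constructor
      · intro h; exact mul_neg_of_pos_of_neg h h1
      · intro h; by_contra hh; push Not at hh; nlinarith
  · have h1 : 0 < p.eval u := by simpa [hx0] using hm hu hxI hx.1
    have h2 : p.eval v < 0 := by simpa [hx0] using hm hxI hv hx.2
    refine ⟨mul_neg_of_pos_of_neg h1 h2, fun z hz => ?_⟩
    have hzI : z ∈ Set.Icc u v := ⟨hz.1.le, hz.2.le⟩
    have e1 := hm.lt_iff_gt hzI hxI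
    have e2 := hm.lt_iff_gt hxI hzI
    simp only [hx0] at e1 e2
    rw [← e1, ← e2]
    constructor
    · constructor
      · intro h; exact mul_pos h h1
      · intro h; by_contra hh; push Not at hh; nlinarith
    · constructor
      · intro h; exact mul_neg_of_neg_of_pos h h1
      · intro h; by_contra hh; push Not at hh; nlinarith

end real

section good
open Polynomial
variable {α : Type*} {D : (α → Prop) → Prop}

/-- evaluation at a parameter. -/
def ev (A : Subalgebra ℝ (α → ℝ)) (a : α) : A →+* ℝ :=
  (Pi.evalRingHom (fun _ => ℝ) a).comp (A.val : A →+* (α → ℝ))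

@[simp] lemma ev_apply (A : Subalgebra ℝ (α → ℝ)) (a : α) (f : A) : ev A a f = (f : α → ℝ) a := rfl

/-- specialization of a polynomial. -/
noncomputable def sp {A : Subalgebra ℝ (α → ℝ)} (P : A[X]) (a : α) : ℝ[X] := P.map (ev A a)

def Good (D : (α → Prop) → Prop) (A : Subalgebra ℝ (α → ℝ)) : Prop :=
  ∀ f ∈ A, D fun a => 0 < f a

structure MaxGood (D : (α → Prop) → Prop) (A : Subalgebra ℝ (α → ℝ)) : Prop where
  ba : IsBA D
  good : Good D A
  max : ∀ A', Good D A' → A ≤ A' → A' ≤ A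

lemma exists_maxGood (hD : IsBA D) (A : Subalgebra ℝ (α → ℝ)) (hA : Good D A) :
    ∃ A', A ≤ A' ∧ MaxGood D A' := by
  obtain ⟨M, hAM, hM⟩ := zorn_le_nonempty₀ {A' : Subalgebra ℝ (α → ℝ) | Good D A'} (by
    intro c hc hch y hy
    refine ⟨sSup c, ?_, fun z hz => le_sSup hz⟩
    intro f hf
    have hf' : (f : α → ℝ) ∈ (↑(sSup c) : Set (α → ℝ)) := hf
    have : Nonempty c := ⟨⟨y, hy⟩⟩
    rw [sSup_eq_iSup', Subalgebra.coe_iSup_of_directed hch.directedOn.directed_val] at hf'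
    simp only [Set.mem_iUnion] at hf'
    obtain ⟨B, hfB⟩ := hf'
    exact hc B.2 f hfB) A hA
  exact ⟨M, hAM, hD, hM.1, fun A' h1 h2 => hM.2 h1 h2⟩

namespace MaxGood
variable {A : Subalgebra ℝ (α → ℝ)}

lemma lt (hA : MaxGood D A) {f g : α → ℝ} (hf : f ∈ A) (hg : g ∈ A) : D fun a => f a < g a := by
  have := hA.good _ (A.sub_mem hg hf)
  simpa using this

lemma le (hA : MaxGood D A) {f g : α → ℝ} (hf : f ∈ A) (hg : g ∈ A) : D fun a => f a ≤ g a := by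
  have := hA.ba.not (hA.lt hg hf)
  simpa using this

lemma eq (hA : MaxGood D A) {f g : α → ℝ} (hf : f ∈ A) (hg : g ∈ A) : D fun a => f a = g a := by
  have := hA.ba.and (hA.le hf hg) (hA.le hg hf)
  simpa [← le_antisymm_iff] using this

lemma aeval_eq (Q : A[X]) (g : α → ℝ) (a : α) : (Polynomial.aeval g Q) a = (sp Q a).eval (g a) := by
  have := Polynomial.hom_eval₂ Q (algebraMap A (α → ℝ)) (Pi.evalRingHom (fun _ => ℝ) a) g
  rw [sp, Polynomial.eval_map]
  exact this

lemma mem (hA : MaxGood D A) {g : α → ℝ} (h : ∀ Q : A[X], D fun a => 0 < (sp Q a).eval (g a)) : g ∈ A := by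
  have := hA.max ((Polynomial.aeval (R := A) g).range.restrictScalars ℝ) (by
    rintro f ⟨Q, rfl⟩
    simpa [aeval_eq] using h Q) (by
    intro f hf
    exact ⟨C ⟨f, hf⟩, by simp⟩)
  apply this
  exact ⟨X, by simp⟩

lemma eval_mem (Q : A[X]) {g : α → ℝ} (hg : g ∈ A) : (fun a => (sp Q a).eval (g a)) ∈ A := by
  have : (fun a => (sp Q a).eval (g a)) = ((Q.eval ⟨g, hg⟩ : A) : α → ℝ) := by
    funext a
    have := Polynomial.hom_eval₂ Q (RingHom.id A) (ev A a) ⟨g, hg⟩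
    rw [sp, Polynomial.eval_map]
    exact this.symm
  rw [this]
  exact (Q.eval ⟨g, hg⟩ : A).2

lemma inv (hA : MaxGood D A) {f : α → ℝ} (hf : f ∈ A) : (fun a => (f a)⁻¹) ∈ A := by
  apply hA.mem
  intro Q
  have h0 : (0 : α → ℝ) ∈ A := A.zero_mem
  have key := hA.ba.or (hA.ba.and (hA.eq hf h0) (hA.lt h0 (eval_mem Q h0)))
    (hA.ba.and (hA.ba.not (hA.eq hf h0))
      (hA.lt h0 (A.mul_mem (eval_mem Q.reverse hf) (A.pow_mem hf Q.natDegree))))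
  refine (congrArg D ?_).mp key
  funext a
  apply propext
  simp only [Pi.zero_apply, Pi.mul_apply, Pi.pow_apply]
  by_cases h : f a = 0
  · simp [h]
  · simp only [h, false_and, not_false_eq_true, true_and, false_or]
    let _ : Invertible (f a)⁻¹ := invertibleOfNonzero (inv_ne_zero h)
    have := Polynomial.eval₂_reverse_mul_pow (ev A a) (f a)⁻¹ Q
    rw [invOf_eq_inv, inv_inv] at this
    rw [sp, sp, Polynomial.eval_map, Polynomial.eval_map, ← this]
    have e : Polynomial.eval₂ (ev A a) (f a) Q.reverse * f a ^ Q.natDegree =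
      (f a ^ Q.natDegree) ^ 2 * (Polynomial.eval₂ (ev A a) (f a) Q.reverse * (f a)⁻¹ ^ Q.natDegree) := by
      have : f a ^ Q.natDegree ≠ 0 := pow_ne_zero _ h
      rw [inv_pow]; field_simp
    rw [e]
    have : 0 < (f a ^ Q.natDegree) ^ 2 := by positivity
    exact mul_pos_iff_of_pos_left this

end MaxGood
end good
end SAProof

namespace SAProof
section roots
open Polynomial
variable {α : Type*} {D : (α → Prop) → Prop} {A : Subalgebra ℝ (α → ℝ)}

lemma exists_below {M : Set (α → ℝ)} (hM : M.Finite) {a : α} {x : ℝ} {u : α → ℝ} (hu : u ∈ M)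
    (hux : u a < x) : ∃ f ∈ M, f a < x ∧ u a ≤ f a ∧ ∀ h ∈ M, h a < x → h a ≤ f a := by
  obtain ⟨f, hf, hf2⟩ := Set.exists_max_image {f ∈ M | f a < x} (fun f => f a)
    (hM.subset (Set.sep_subset _ _)) ⟨u, hu, hux⟩
  exact ⟨f, hf.1, hf.2, hf2 u ⟨hu, hux⟩, fun h h1 h2 => hf2 h ⟨h1, h2⟩⟩

lemma exists_above {M : Set (α → ℝ)} (hM : M.Finite) {a : α} {x : ℝ} {u : α → ℝ} (hu : u ∈ M)
    (hux : x < u a) : ∃ f ∈ M, x < f a ∧ f a ≤ u a ∧ ∀ h ∈ M, x < h a → f a ≤ h a := by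
  obtain ⟨f, hf, hf2⟩ := Set.exists_min_image {f ∈ M | x < f a} (fun f => f a)
    (hM.subset (Set.sep_subset _ _)) ⟨u, hu, hux⟩
  exact ⟨f, hf.1, hf.2, hf2 u ⟨hu, hux⟩, fun h h1 h2 => hf2 h ⟨h1, h2⟩⟩

/-- The real roots of all specializations are enumerated by finitely many functions in `A`. -/
def HasRoots (P : A[X]) : Prop :=
  ∃ L : Set (α → ℝ), L.Finite ∧ (∀ f ∈ L, f ∈ A) ∧
    ∀ a x, sp P a ≠ 0 → (sp P a).eval x = 0 → ∃ f ∈ L, f a = x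

lemma half_mem {f g : α → ℝ} (hf : f ∈ A) (hg : g ∈ A) : (fun a => (f a + g a) / 2) ∈ A := by
  have := A.smul_mem (A.add_mem hf hg) (1/2 : ℝ)
  refine (congrArg (· ∈ A) ?_).mp this
  funext a
  simp; ring

/-- the isolating condition -/
def Iso (P : A[X]) (L : Set (α → ℝ)) (u v : α → ℝ) (a : α) : Prop :=
  u a < v a ∧ (∀ f ∈ L, ¬ (u a < f a ∧ f a < v a)) ∧
    (sp P a).eval (u a) * (sp P a).eval (v a) < 0

lemma iso_exists {P : A[X]} {L : Set (α → ℝ)} {u v : α → ℝ} {a : α} (h : Iso P L u v a) :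
    ∃ x ∈ Set.Ioo (u a) (v a), (sp P a).eval x = 0 := root_exists h.1 h.2.2

open Classical in
noncomputable def rt (P : A[X]) (L : Set (α → ℝ)) (u v : α → ℝ) (a : α) : ℝ :=
  if h : Iso P L u v a then (iso_exists h).choose else 0

lemma rt_mem (hA : MaxGood D A) {P : A[X]} 
    (hrem : ∀ Q : A[X], HasRoots (Q %ₘ P))
    {L : Set (α → ℝ)} (hL : L.Finite) (hLA : ∀ f ∈ L, f ∈ A)
    (hder : ∀ a x, (sp P a).derivative.eval x = 0 → ∃ f ∈ L, f a = x)
    {u v : α → ℝ} (hu : u ∈ A) (hv : v ∈ A) : rt P L u v ∈ A := by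
  have h0 : (0 : α → ℝ) ∈ A := A.zero_mem
  have hE : D fun a => Iso P L u v a := by
    unfold Iso
    exact hA.ba.and (hA.lt hu hv) (hA.ba.and
      (hA.ba.all hL fun f hf => hA.ba.not (hA.ba.and (hA.lt hu (hLA f hf)) (hA.lt (hLA f hf) hv)))
      (hA.lt (A.mul_mem (MaxGood.eval_mem P hu) (MaxGood.eval_mem P hv)) h0))
  apply hA.mem
  intro Q
  obtain ⟨LR, hLR, hLRA, hroots⟩ := hrem Q
  set R := Q %ₘ P with hR
  set M : Set (α → ℝ) := insert u (insert v LR) with hMdef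
  have hM : M.Finite := (hLR.insert v).insert u
  have hMA : ∀ f ∈ M, f ∈ A := by
    rintro f (rfl | rfl | hf)
    exacts [hu, hv, hLRA f hf]
  have hlt : ∀ f ∈ A, D fun a => f a ≤ u a ∨ (f a < v a ∧
      0 < (sp P a).eval (f a) * (sp P a).eval (u a)) := fun f hf =>
    hA.ba.or (hA.le hf hu) (hA.ba.and (hA.lt hf hv)
      (hA.lt h0 (A.mul_mem (MaxGood.eval_mem P hf) (MaxGood.eval_mem P hu))))
  have hgt : ∀ f ∈ A, D fun a => v a ≤ f a ∨ (u a < f a ∧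
      (sp P a).eval (f a) * (sp P a).eval (u a) < 0) := fun f hf =>
    hA.ba.or (hA.le hv hf) (hA.ba.and (hA.lt hu hf)
      (hA.lt (A.mul_mem (MaxGood.eval_mem P hf) (MaxGood.eval_mem P hu)) h0))
  have key := hA.ba.or (hA.ba.and (hA.ba.not hE) (hA.lt h0 (MaxGood.eval_mem Q h0)))
    (hA.ba.and hE (hA.ba.exi hM fun f hf => hA.ba.exi hM fun g hg =>
      hA.ba.and (hlt f (hMA f hf)) (hA.ba.and (hgt g (hMA g hg)) (hA.ba.and
        (hA.lt h0 (MaxGood.eval_mem R (half_mem (hMA f hf) (hMA g hg))))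
        (hA.ba.all hM fun h hh => hA.ba.not (hA.ba.and (hA.ba.and (hA.lt (hMA f hf) (hMA h hh))
          (hA.lt (hMA h hh) (hMA g hg))) (hA.eq (MaxGood.eval_mem R (hMA h hh)) h0)))))))
  refine (congrArg D ?_).mp key
  funext a
  apply propext
  by_cases hEa : Iso P L u v a
  swap
  · simp [hEa, rt]
  have hx := (iso_exists hEa).choose_spec
  have hrt : rt P L u v a = (iso_exists hEa).choose := by simp [rt, hEa]
  rw [← hrt] at hx
  set x := rt P L u v a with hxdef
  obtain ⟨hxI, hx0⟩ := hx
  have hQR : (sp Q a).eval x = (sp R a).eval x := by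
    have := Polynomial.modByMonic_add_div Q P
    have h2 : sp Q a = sp R a + sp P a * sp (Q /ₘ P) a := by
      rw [hR]; simp only [sp]
      rw [← Polynomial.map_mul, ← Polynomial.map_add, this]
    rw [h2]; simp [hx0]
  have hno : ∀ z ∈ Set.Ioo (u a) (v a), (sp P a).derivative.eval z ≠ 0 := by
    intro z hz h
    obtain ⟨f, hf, rfl⟩ := hder a z h
    exact hEa.2.1 f hf ⟨hz.1, hz.2⟩
  obtain ⟨-, hs⟩ := root_sign hno hxI hx0
  have clt : ∀ z : ℝ, (z ≤ u a ∨ (z < v a ∧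
      0 < (sp P a).eval z * (sp P a).eval (u a))) ↔ z < x := by
    intro z
    by_cases h1 : z ≤ u a
    · simp [h1, h1.trans_lt hxI.1]
    · by_cases h2 : z < v a
      · simp only [h1, h2, true_and, false_or]
        exact (hs z ⟨not_le.mp h1, h2⟩).1.symm
      · simp only [h1, h2, false_and, false_or, false_iff, not_lt]
        exact hxI.2.le.trans (not_lt.mp h2)
  have cgt : ∀ z : ℝ, (v a ≤ z ∨ (u a < z ∧
      (sp P a).eval z * (sp P a).eval (u a) < 0)) ↔ x < z := by
    intro z
    by_cases h1 : v a ≤ z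
    · simp [h1, hxI.2.trans_le h1]
    · by_cases h2 : u a < z
      · simp only [h1, h2, true_and, false_or]
        exact (hs z ⟨h2, not_le.mp h1⟩).2.symm
      · simp only [h1, h2, false_and, false_or, false_iff, not_lt]
        exact (not_lt.mp h2).trans hxI.1.le
  simp only [hEa, not_true_eq_false, false_and, true_and, false_or, clt, cgt, hQR, Pi.zero_apply]
  constructor
  · rintro ⟨f, hf, g, hg, h1, h2, h3, h4⟩
    have hR0 : sp R a ≠ 0 := by rintro h; simp [h] at h3
    refine pos_of_no_root (x := (f a + g a) / 2) ?_ h3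
    intro z hz hz0
    obtain ⟨h, hh, rfl⟩ := hroots a z hR0 hz0
    refine h4 h (by simp [hMdef, hh]) ⟨?_, hz0⟩
    have : Set.uIcc ((f a + g a) / 2) x ⊆ Set.Ioo (f a) (g a) :=
      Set.OrdConnected.uIcc_subset Set.ordConnected_Ioo ⟨by linarith, by linarith⟩ ⟨h1, h2⟩
    exact this hz
  · intro hpos
    have hR0 : sp R a ≠ 0 := by rintro h; simp [h] at hpos
    obtain ⟨f, hf, hfx, -, hf2⟩ := exists_below hM (u := u) (by simp [hMdef]) hxI.1
    obtain ⟨g, hg, hgx, -, hg2⟩ := exists_above hM (u := v) (by simp [hMdef]) hxI.2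
    have h4 : ∀ h ∈ M, ¬ ((f a < h a ∧ h a < g a) ∧ (sp R a).eval (h a) = 0) := by
      rintro h hh ⟨⟨ha, hb⟩, hc⟩
      rcases lt_trichotomy (h a) x with hl | hl | hl
      · exact absurd (hf2 h hh hl) (not_le.mpr ha)
      · rw [hl] at hc; exact hpos.ne' hc
      · exact absurd (hg2 h hh hl) (not_le.mpr hb)
    refine ⟨f, hf, g, hg, hfx, hgx, ?_, h4⟩
    refine pos_of_no_root (x := x) ?_ hpos
    intro z hz hz0
    obtain ⟨h, hh, rfl⟩ := hroots a z hR0 hz0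
    refine h4 h (by simp [hMdef, hh]) ⟨?_, hz0⟩
    have : Set.uIcc x ((f a + g a) / 2) ⊆ Set.Ioo (f a) (g a) :=
      Set.OrdConnected.uIcc_subset Set.ordConnected_Ioo ⟨hfx, hgx⟩ ⟨by linarith, by linarith⟩ 
    exact this hz

lemma bound_root {p : ℝ[X]} (hp : p.Monic) {x : ℝ} (hx : p.eval x = 0) :
    |x| < (∑ i ∈ Finset.range p.natDegree, (1 + (p.coeff i) ^ 2)) + 1 := by
  have h := Polynomial.IsRoot.norm_lt_cauchyBound hp.ne_zero (a := x) hx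
  have h' : |x| < (p.cauchyBound : ℝ) := by
    have := NNReal.coe_lt_coe.mpr h
    simpa using this
  refine h'.trans_le ?_
  rw [Polynomial.cauchyBound, hp.leadingCoeff]
  simp only [nnnorm_one, div_one, NNReal.coe_add, NNReal.coe_one, add_le_add_iff_right]
  have hnn : ∀ i ∈ Finset.range p.natDegree, 0 ≤ 1 + (p.coeff i)^2 := fun i _ => by positivity
  have : (Finset.sup (Finset.range p.natDegree) fun i => ‖p.coeff i‖₊) ≤
      (∑ i ∈ Finset.range p.natDegree, (1 + (p.coeff i) ^ 2)).toNNReal := by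
    apply Finset.sup_le
    intro i hi
    rw [← NNReal.coe_le_coe, Real.coe_toNNReal _ (Finset.sum_nonneg hnn)]
    refine le_trans ?_ (Finset.single_le_sum hnn hi)
    simp only [coe_nnnorm, Real.norm_eq_abs]
    nlinarith [sq_abs (p.coeff i), abs_nonneg (p.coeff i), sq_nonneg (|p.coeff i| - 1)]
  have h2 := NNReal.coe_le_coe.mpr this
  rwa [Real.coe_toNNReal _ (Finset.sum_nonneg hnn)] at h2

lemma monic_step [Nonempty α] (hA : MaxGood D A) {d : ℕ} (ih : ∀ P : A[X], P.natDegree ≤ d → HasRoots P)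
    (P : A[X]) (hP : P.Monic) (hd : P.natDegree = d + 1) : HasRoots P := by
  have hsm : ∀ a, (sp P a).Monic := fun a => hP.map _
  have hsd : ∀ a, (sp P a).natDegree = d + 1 := fun a => by
    rw [← hd]; exact hP.natDegree_map _
  have hrem : ∀ Q : A[X], HasRoots (Q %ₘ P) := by
    intro Q
    apply ih
    have := Polynomial.natDegree_modByMonic_lt Q hP (by
      rintro rfl; simp at hd)
    omega
  obtain ⟨L, hL, hLA, hroots⟩ := ih P.derivative (by
    have := Polynomial.natDegree_derivative_le P; omega)
  have hsp' : ∀ a, sp P.derivative a = (sp P a).derivative := fun a => by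
    simp [sp, Polynomial.derivative_map]
  have hder : ∀ a x, (sp P a).derivative.eval x = 0 → ∃ f ∈ L, f a = x := by
    intro a x hx
    apply hroots a x
    · rw [hsp']
      intro h
      have := Polynomial.derivative_eq_zero.mp h
      rw [hsd] at this; omega
    · rw [hsp']; exact hx
  let B : A := (∑ i ∈ Finset.range P.natDegree, (1 + (P.coeff i) ^ 2)) + 1
  have hB : ∀ a x, (sp P a).eval x = 0 → |x| < (B : α → ℝ) a := by
    intro a x hx
    have := bound_root (hsm a) hx
    rw [hsd, ← hd] at this
    refine this.trans_le (le_of_eq ?_)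
    change _ = ev A a B
    simp only [B, map_add, map_sum, map_one, map_pow, sp, Polynomial.coeff_map]
  set M : Set (α → ℝ) := insert (-B : A).1 (insert B.1 L) with hMdef
  have hM : M.Finite := (hL.insert _).insert _
  have hMA : ∀ f ∈ M, f ∈ A := by
    rintro f (rfl | rfl | hf)
    exacts [(-B).2, B.2, hLA f hf]
  refine ⟨L ∪ Set.image2 (fun u v => rt P L u v) M M, hL.union (hM.image2 _ hM), ?_, ?_⟩
  · rintro f (hf | ⟨u, hu, v, hv, rfl⟩)
    · exact hLA f hf
    · exact rt_mem hA hrem hL hLA hder (hMA u hu) (hMA v hv)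
  · intro a x _ hx
    by_cases hxL : ∃ f ∈ L, f a = x
    · obtain ⟨f, hf, h⟩ := hxL
      exact ⟨f, Or.inl hf, h⟩
    have hb := abs_lt.mp (hB a x hx)
    obtain ⟨f, hf, hfx, -, hf2⟩ := exists_below hM (u := (-B : A).1) (a := a) (x := x)
      (by simp [hMdef]) (by simpa using hb.1)
    obtain ⟨g, hg, hgx, -, hg2⟩ := exists_above hM (u := B.1) (a := a) (x := x)
      (by simp [hMdef]) hb.2
    have hno : ∀ h ∈ L, ¬ (f a < h a ∧ h a < g a) := by
      rintro h hh ⟨ha, hb⟩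
      have hhM : h ∈ M := by simp [hMdef, hh]
      rcases lt_trichotomy (h a) x with hl | hl | hl
      · exact absurd (hf2 h hhM hl) (not_le.mpr ha)
      · exact hxL ⟨h, hh, hl⟩
      · exact absurd (hg2 h hhM hl) (not_le.mpr hb)
    have hno' : ∀ z ∈ Set.Ioo (f a) (g a), (sp P a).derivative.eval z ≠ 0 := by
      intro z hz h
      obtain ⟨f, hf, rfl⟩ := hder a z h
      exact hno f hf ⟨hz.1, hz.2⟩
    obtain ⟨hneg, hs⟩ := root_sign hno' ⟨hfx, hgx⟩ hx
    have hiso : Iso P L f g a := ⟨hfx.trans hgx, hno, hneg⟩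
    refine ⟨rt P L f g, Or.inr ⟨f, hf, g, hg, rfl⟩, ?_⟩
    have hy := (iso_exists hiso).choose_spec
    have hrt : rt P L f g a = (iso_exists hiso).choose := by simp [rt, hiso]
    rw [← hrt] at hy
    obtain ⟨h1, h2⟩ := hs _ hy.1
    rw [hy.2] at h1 h2
    simp only [zero_mul, lt_irrefl, iff_false, not_lt] at h1 h2
    exact le_antisymm h2 h1

lemma hasRoots_le [Nonempty α] (hA : MaxGood D A) (d : ℕ) :
    ∀ P : A[X], P.natDegree ≤ d → HasRoots P := by
  induction d with
  | zero =>
    intro P hP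
    refine ⟨∅, Set.finite_empty, by simp, ?_⟩
    intro a x h1 h2
    rw [Polynomial.eq_C_of_natDegree_le_zero hP] at h1 h2
    simp only [sp, Polynomial.map_C, Polynomial.eval_C] at h1 h2
    rw [h2] at h1
    simp at h1
  | succ d ih =>
    intro P hP
    let c := P.coeff (d + 1)
    let ci : A := ⟨fun a => (c.1 a)⁻¹, hA.inv c.2⟩
    let P0 : A[X] := P.erase (d + 1)
    have hP0 : P0.degree < ((d + 1 : ℕ) : WithBot ℕ) := by
      rw [Polynomial.degree_lt_iff_coeff_zero]
      intro m hm
      by_cases h : m = d + 1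
      · simp [P0, h]
      · rw [Polynomial.erase_ne _ h]
        exact Polynomial.coeff_eq_zero_of_natDegree_lt (by omega)
    have hP0' : P0.natDegree ≤ d := by
      rw [Polynomial.natDegree_le_iff_coeff_eq_zero]
      intro N hN
      exact (Polynomial.degree_lt_iff_coeff_zero _ _).mp hP0 N hN
    have hdec : P = Polynomial.monomial (d + 1) c + P0 := 
      (Polynomial.monomial_add_erase P (d+1)).symm
    have hci : (Polynomial.C ci * P0).degree < ((d + 1 : ℕ) : WithBot ℕ) :=
      lt_of_le_of_lt (by
        rw [Polynomial.C_mul']; exact Polynomial.degree_smul_le _ _) hP0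
    let P1 : A[X] := Polynomial.X ^ (d + 1) + Polynomial.C ci * P0
    have hm : P1.Monic := Polynomial.monic_X_pow_add hci
    have hd1 : P1.natDegree = d + 1 := by
      apply Polynomial.natDegree_eq_of_degree_eq_some
      rw [Polynomial.degree_add_eq_left_of_degree_lt (by rwa [Polynomial.degree_X_pow]),
        Polynomial.degree_X_pow]
    obtain ⟨L1, h11, h12, h13⟩ := monic_step hA ih P1 hm hd1
    obtain ⟨L0, h01, h02, h03⟩ := ih P0 hP0'
    refine ⟨L1 ∪ L0, h11.union h01, ?_, ?_⟩
    · rintro f (hf | hf)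
      exacts [h12 f hf, h02 f hf]
    · intro a x hne hx
      have hspd : sp P a = Polynomial.monomial (d + 1) (c.1 a) + sp P0 a := by
        conv_lhs => rw [hdec]
        simp [sp]
      by_cases hc : c.1 a = 0
      · rw [hc] at hspd
        simp only [Polynomial.monomial_zero_right, zero_add] at hspd
        rw [hspd] at hne hx
        obtain ⟨f, hf, h⟩ := h03 a x hne hx
        exact ⟨f, Or.inr hf, h⟩
      · obtain ⟨f, hf, h⟩ := h13 a x (hm.map _).ne_zero (by
          rw [hspd] at hx
          simp only [Polynomial.eval_add, Polynomial.eval_monomial] at hx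
          simp only [P1, sp, Polynomial.map_add, Polynomial.map_pow, Polynomial.map_X, 
            Polynomial.map_mul, Polynomial.map_C, Polynomial.eval_add, Polynomial.eval_pow,
            Polynomial.eval_X, Polynomial.eval_mul, Polynomial.eval_C, ev_apply, ci]
          change x ^ (d+1) + (c.1 a)⁻¹ * (sp P0 a).eval x = 0
          rw [show (sp P0 a).eval x = - (c.1 a * x ^ (d+1)) by linarith]
          field_simp
          ring)
        exact ⟨f, Or.inl hf, h⟩

lemma hasRoots [Nonempty α] (hA : MaxGood D A) (P : A[X]) : HasRoots P := 
  hasRoots_le hA _ P le_rfl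

/-- Finitely many test functions realize all sign patterns of a finite family of polynomials. -/
lemma test_points [Nonempty α] (hA : MaxGood D A) {F : Set A[X]} (hF : F.Finite) :
    ∃ T : Set (α → ℝ), T.Finite ∧ (∀ f ∈ T, f ∈ A) ∧ ∀ a x, ∃ c ∈ T, ∀ P ∈ F,
      (0 < (sp P a).eval x ↔ 0 < (sp P a).eval (c a)) := by
  choose L hL hLA hr using fun P : A[X] => hasRoots hA P
  set M : Set (α → ℝ) := ⋃ P ∈ F, L P with hMdef
  have hM : M.Finite := hF.biUnion fun P _ => hL P
  have hMA : ∀ f ∈ M, f ∈ A := by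
    intro f hf
    simp only [hMdef, Set.mem_iUnion] at hf
    obtain ⟨P, _, h⟩ := hf
    exact hLA P f h
  set T : Set (α → ℝ) := insert 0 (M ∪ Set.image2 (fun f g => fun a => (f a + g a) / 2) M M ∪
    ((fun f => f + 1) '' M ∪ (fun f => f - 1) '' M)) with hT
  have hmain : ∀ a x y, (∀ f ∈ M, f a ∉ Set.uIcc x y) → ∀ P ∈ F,
      (0 < (sp P a).eval x ↔ 0 < (sp P a).eval y) := by
    intro a x y h P hP
    by_cases h0 : sp P a = 0
    · simp [h0]
    have hz : ∀ z ∈ Set.uIcc x y, (sp P a).eval z ≠ 0 := by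
      intro z hz hz0
      obtain ⟨f, hf, rfl⟩ := hr P a z h0 hz0
      exact h f (by simp only [hMdef, Set.mem_iUnion]; exact ⟨P, hP, hf⟩) hz
    exact ⟨fun hp => pos_of_no_root hz hp,
      fun hp => pos_of_no_root (fun z h' => hz z (by rwa [Set.uIcc_comm])) hp⟩
  refine ⟨T, ?_, ?_, ?_⟩
  · exact ((hM.union (hM.image2 _ hM)).union ((hM.image _).union (hM.image _))).insert _
  · rintro f (rfl | (hf | ⟨f, hf, g, hg, rfl⟩) | (⟨f, hf, rfl⟩ | ⟨f, hf, rfl⟩))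
    · exact A.zero_mem
    · exact hMA f hf
    · exact half_mem (hMA f hf) (hMA g hg)
    · exact A.add_mem (hMA f hf) A.one_mem
    · exact A.sub_mem (hMA f hf) A.one_mem
  · intro a x
    by_cases hxM : ∃ f ∈ M, f a = x
    · obtain ⟨f, hf, rfl⟩ := hxM
      exact ⟨f, by simp [hT, hf], fun P _ => Iff.rfl⟩
    push Not at hxM
    by_cases hb : ∃ f ∈ M, f a < x
    · obtain ⟨u, hu, hux⟩ := hb
      obtain ⟨f, hf, hfx, -, hf2⟩ := exists_below hM hu hux
      by_cases hc : ∃ g ∈ M, x < g a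
      · obtain ⟨v, hv, hvx⟩ := hc
        obtain ⟨g, hg, hgx, -, hg2⟩ := exists_above hM hv hvx
        refine ⟨fun a => (f a + g a) / 2, Or.inr (Or.inl (Or.inr ⟨f, hf, g, hg, rfl⟩)), 
          hmain a _ _ ?_⟩
        intro h hh hmem
        have : Set.uIcc x ((f a + g a) / 2) ⊆ Set.Ioo (f a) (g a) :=
          Set.OrdConnected.uIcc_subset Set.ordConnected_Ioo ⟨hfx, hgx⟩ ⟨by linarith, by linarith⟩ 
        have := this hmem
        rcases lt_trichotomy (h a) x with hl | hl | hl
        · exact absurd (hf2 h hh hl) (not_le.mpr this.1)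
        · exact hxM h hh hl
        · exact absurd (hg2 h hh hl) (not_le.mpr this.2)
      · push Not at hc
        refine ⟨f + 1, Or.inr (Or.inr (Or.inl ⟨f, hf, rfl⟩)), hmain a _ _ ?_⟩
        intro h hh hmem
        have : Set.uIcc x ((f + 1) a) ⊆ Set.Ioi (f a) :=
          Set.OrdConnected.uIcc_subset Set.ordConnected_Ioi hfx (by simp)
        have := this hmem
        exact absurd (hf2 h hh (lt_of_le_of_ne (hc h hh) (hxM h hh))) (not_le.mpr this)
    · push Not at hb
      by_cases hc : ∃ g ∈ M, x < g a
      · obtain ⟨v, hv, hvx⟩ := hc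
        obtain ⟨g, hg, hgx, -, hg2⟩ := exists_above hM hv hvx
        refine ⟨g - 1, Or.inr (Or.inr (Or.inr ⟨g, hg, rfl⟩)), hmain a _ _ ?_⟩
        intro h hh hmem
        have : Set.uIcc x ((g - 1) a) ⊆ Set.Iio (g a) :=
          Set.OrdConnected.uIcc_subset Set.ordConnected_Iio hgx (by simp)
        have := this hmem
        exact absurd (hg2 h hh (lt_of_le_of_ne (hb h hh) (hxM h hh).symm)) (not_le.mpr this)
      · push Not at hc
        refine ⟨0, Or.inl rfl, hmain a _ _ ?_⟩
        intro h hh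
        exact absurd (le_antisymm (hc h hh) (hb h hh)) (hxM h hh)

end roots
end SAProof

namespace SAProof
section semialg
variable {ι : Type*}

/-- Semialgebraic predicates. -/
inductive SA : ((ι → ℝ) → Prop) → Prop
  | pos (p : MvPolynomial ι ℝ) : SA (fun v => 0 < MvPolynomial.eval v p)
  | tru : SA (fun _ => True)
  | not {p : (ι → ℝ) → Prop} (h : SA p) : SA (fun v => ¬ p v)
  | and {p q : (ι → ℝ) → Prop} (h : SA p) (h' : SA q) : SA (fun v => p v ∧ q v)

lemma isBA_SA : IsBA (SA (ι := ι)) := ⟨.tru, .not, .and⟩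

lemma SA.lt (p q : MvPolynomial ι ℝ) : SA fun v => MvPolynomial.eval v p < MvPolynomial.eval v q := by
  have := SA.pos (q - p)
  simpa using this

lemma SA.eq (p q : MvPolynomial ι ℝ) : SA fun v => MvPolynomial.eval v p = MvPolynomial.eval v q := by
  have := (SA.lt p q).not.and (SA.lt q p).not
  refine (congrArg SA ?_).mp this
  funext v; apply propext
  rw [not_lt, not_lt, and_comm]
  exact le_antisymm_iff.symm

lemma SA.determined {E : (ι → ℝ) → Prop} (h : SA E) : ∃ F : Set (MvPolynomial ι ℝ), F.Finite ∧
    ∀ v w, (∀ p ∈ F, (0 < MvPolynomial.eval v p ↔ 0 < MvPolynomial.eval w p)) → (E v ↔ E w) := by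
  induction h with
  | pos p => exact ⟨{p}, Set.finite_singleton _, fun v w h => h p rfl⟩
  | tru => exact ⟨∅, Set.finite_empty, by simp⟩
  | not _ ih =>
    obtain ⟨F, hF, h⟩ := ih
    exact ⟨F, hF, fun v w h' => not_congr (h v w h')⟩
  | and _ _ ih1 ih2 =>
    obtain ⟨F, hF, h⟩ := ih1
    obtain ⟨G, hG, h2⟩ := ih2
    exact ⟨F ∪ G, hF.union hG, fun v w h' => and_congr (h v w fun p hp => h' p (Or.inl hp))
      (h2 v w fun p hp => h' p (Or.inr hp))⟩

/-- the algebra of polynomial functions -/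
noncomputable def A0 (ι : Type*) : Subalgebra ℝ ((ι → ℝ) → ℝ) :=
  (MvPolynomial.aeval (R := ℝ) (fun (i : ι) (v : ι → ℝ) => v i)).range

lemma aeval_fun {β : Type*} (g : ι → β → ℝ) (p : MvPolynomial ι ℝ) (v : β) :
    MvPolynomial.aeval (R := ℝ) g p v = MvPolynomial.eval (fun i => g i v) p := by
  induction p using MvPolynomial.induction_on with
  | C a => simp
  | add p q hp hq => simp [hp, hq]
  | mul_X p i hp => simp [hp]

lemma A0_good : Good (SA (ι := ι)) (A0 ι) := by
  rintro f ⟨p, rfl⟩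
  have := SA.pos p
  refine (congrArg SA ?_).mp this
  funext v
  congr 1
  exact (aeval_fun (fun (i : ι) (v : ι → ℝ) => v i) p v).symm

lemma coord_mem (i : ι) : (fun v : ι → ℝ => v i) ∈ A0 ι := ⟨MvPolynomial.X i, by simp⟩

lemma eval_mem_of {β : Type*} {A : Subalgebra ℝ (β → ℝ)} {g : ι → β → ℝ} (hg : ∀ i, g i ∈ A)
    (p : MvPolynomial ι ℝ) : (fun v => MvPolynomial.eval (fun i => g i v) p) ∈ A := by
  induction p using MvPolynomial.induction_on with
  | C a =>
    have := A.algebraMap_mem a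
    simp only [MvPolynomial.eval_C]
    exact this
  | add p q hp hq =>
    simp only [map_add]
    exact A.add_mem hp hq
  | mul_X p i hp =>
    simp only [map_mul, MvPolynomial.eval_X]
    exact A.mul_mem hp (hg i)

lemma SA.comp {β : Type*} {D : (β → Prop) → Prop} {A : Subalgebra ℝ (β → ℝ)} (hA : MaxGood D A)
    {g : ι → β → ℝ} (hg : ∀ i, g i ∈ A) {E : (ι → ℝ) → Prop} (h : SA E) :
    D fun v => E (fun i => g i v) := by
  induction h with
  | pos p => exact hA.good _ (eval_mem_of hg p)
  | tru => exact hA.ba.tru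
  | not _ ih => exact hA.ba.not ih
  | and _ _ ih1 ih2 => exact hA.ba.and ih1 ih2

open Polynomial in
lemma exists_poly [DecidableEq ι] {A : Subalgebra ℝ ((ι → ℝ) → ℝ)} (hA : A0 ι ≤ A) (i : ι)
    (p : MvPolynomial ι ℝ) : ∃ P : A[X], ∀ v x,
      (sp P v).eval x = MvPolynomial.eval (Function.update v i x) p := by
  induction p using MvPolynomial.induction_on with
  | C a => exact ⟨Polynomial.C (algebraMap ℝ A a), fun v x => by simp [sp]⟩
  | add p q hp hq =>
    obtain ⟨P, hP⟩ := hp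
    obtain ⟨Q, hQ⟩ := hq
    refine ⟨P + Q, fun v x => ?_⟩
    rw [map_add, ← hP, ← hQ]; simp [sp]
  | mul_X p j hp =>
    obtain ⟨P, hP⟩ := hp
    by_cases h : j = i
    · subst h
      refine ⟨P * Polynomial.X, fun v x => ?_⟩
      rw [map_mul, ← hP]; simp [sp]
    · refine ⟨P * Polynomial.C ⟨_, hA (coord_mem j)⟩, fun v x => ?_⟩
      rw [map_mul, ← hP]; simp [sp, h]

/-- Tarski–Seidenberg: elimination of one existential quantifier. -/
lemma SA.ex [DecidableEq ι] {E : (ι → ℝ) → Prop} (h : SA E) (i : ι) :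
    SA fun v => ∃ x, E (Function.update v i x) := by
  obtain ⟨A, hA0, hA⟩ := exists_maxGood isBA_SA (A0 ι) A0_good
  obtain ⟨F, hF, hdet⟩ := h.determined
  choose P hP using exists_poly hA0 i
  obtain ⟨T, hT, hTA, htest⟩ := test_points hA (hF.image P)
  have key : SA fun v => ∃ c ∈ T, E (Function.update v i (c v)) := by
    apply isBA_SA.exi hT
    intro c hc
    have := h.comp hA (g := fun j => if j = i then c else fun v => v j) (by
      intro j
      by_cases hj : j = i
      · simpa [hj] using hTA c hc
      · simpa [hj] using hA0 (coord_mem j))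
    refine (congrArg SA ?_).mp this
    funext v
    congr 1
    funext j
    by_cases hj : j = i
    · subst hj; simp
    · simp [hj]
  refine (congrArg SA ?_).mp key
  funext v; apply propext
  constructor
  · rintro ⟨c, -, h⟩; exact ⟨_, h⟩
  · rintro ⟨x, hx⟩
    obtain ⟨c, hc, hs⟩ := htest v x
    refine ⟨c, hc, (hdet _ _ ?_).mp hx⟩
    intro p hp
    have := hs (P p) ⟨p, hp, rfl⟩
    rwa [hP, hP] at this

lemma SA.exs [DecidableEq ι] {E : (ι → ℝ) → Prop} (h : SA E) (s : Finset ι) :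
    SA fun v => ∃ w : ι → ℝ, E (s.piecewise w v) := by
  induction s using Finset.induction_on with
  | empty => simpa using h
  | @insert i s hi ih =>
    refine (congrArg SA ?_).mp (ih.ex i)
    funext v; apply propext
    constructor
    · rintro ⟨x, w, hw⟩
      refine ⟨Function.update w i x, ?_⟩
      convert hw using 1
      funext j
      by_cases hj : j = i
      · subst hj; simp [Finset.piecewise, hi]
      · simp [Finset.piecewise, hj]
    · rintro ⟨w, hw⟩
      refine ⟨w i, w, ?_⟩
      convert hw using 1
      funext j
      by_cases hj : j = i
      · subst hj; simp [Finset.piecewise, hi]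
      · simp [Finset.piecewise, hj]

end semialg

section twovar
open Polynomial

lemma lower_bound {b : ℝ[X]} (hb : b ≠ 0) : ∃ c : ℝ, 0 < c ∧ c ≤ 1 ∧ ∃ m : ℕ, ∀ s, 0 < s → s < c →
    c * s ^ m ≤ |b.eval s| := by
  obtain ⟨r, hr, hd⟩ := Polynomial.exists_eq_pow_rootMultiplicity_mul_and_not_dvd b hb 0
  have hr0 : r.eval 0 ≠ 0 := fun h => hd (Polynomial.dvd_iff_isRoot.mpr h)
  have hpos : 0 < |r.eval 0| := abs_pos.mpr hr0
  have hcont : ContinuousAt (fun s => |r.eval s|) 0 := r.continuous.abs.continuousAt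
  have hev : ∀ᶠ s in nhds (0:ℝ), |r.eval 0| / 2 < |r.eval s| :=
    hcont.eventually (lt_mem_nhds (by linarith))
  obtain ⟨ε, hε, hball⟩ := Metric.eventually_nhds_iff.mp hev
  refine ⟨min 1 (min ε (|r.eval 0| / 2)), by positivity, min_le_left _ _,
    b.rootMultiplicity 0, fun s hs hsc => ?_⟩
  have h1 : s < ε := hsc.trans_le ((min_le_right _ _).trans (min_le_left _ _))
  have h2 : |r.eval 0| / 2 < |r.eval s| := hball (by simpa [abs_of_pos hs] using h1)
  have h3 : min 1 (min ε (|r.eval 0| / 2)) ≤ |r.eval 0| / 2 :=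
    (min_le_right _ _).trans (min_le_right _ _)
  conv_rhs => rw [hr]
  simp only [map_zero, sub_zero, Polynomial.eval_mul, Polynomial.eval_pow, Polynomial.eval_X,
    abs_mul, abs_pow, abs_of_pos hs]
  rw [mul_comm]
  exact mul_le_mul_of_nonneg_left (h3.trans h2.le) (by positivity)

lemma two_var (q : ℝ[X][X]) : ∃ c : ℝ, 0 < c ∧ c ≤ 1 ∧ ∃ m : ℕ, ∀ s, 0 < s → s < c →
    ∀ t t', 0 < t → t < c * s ^ m → 0 < t' → t' < c * s ^ m →
      (0 < q.evalEval s t ↔ 0 < q.evalEval s t') := by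
  by_cases hq : q = 0
  · exact ⟨1, one_pos, le_rfl, 0, fun s _ _ t t' _ _ _ _ => by simp [hq]⟩
  obtain ⟨r, hr, hd⟩ := Polynomial.exists_eq_pow_rootMultiplicity_mul_and_not_dvd q hq 0
  rw [map_zero, sub_zero] at hr hd
  have hr0 : r.coeff 0 ≠ 0 := fun h => hd (Polynomial.X_dvd_iff.mpr h)
  obtain ⟨c, hc, hc1, m, hlow⟩ := lower_bound hr0
  have hcont : Continuous fun z : ℝ × ℝ => r.divX.evalEval z.1 z.2 := by
    have : ∀ p : ℝ[X][X], Continuous fun z : ℝ × ℝ => p.evalEval z.1 z.2 := by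
      intro p
      induction p using Polynomial.induction_on' with
      | add p q hp hq =>
        simp only [Polynomial.evalEval_add]
        exact hp.add hq
      | monomial n a =>
        have : (fun z : ℝ × ℝ => (Polynomial.monomial n a).evalEval z.1 z.2) =
            fun z => a.eval z.1 * z.2 ^ n := by
          funext z; simp [Polynomial.evalEval, Polynomial.eval_monomial]
        rw [this]
        exact (a.continuous.comp continuous_fst).mul (continuous_snd.pow n)
    exact this _
  obtain ⟨K, hK⟩ := (isCompact_Icc.prod isCompact_Icc :
    IsCompact (Set.Icc (0:ℝ) 1 ×ˢ Set.Icc (0:ℝ) 1)).exists_bound_of_continuousOn hcont.continuousOn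
  have hK0 : 0 < |K| + 1 := by positivity
  have hcK : c / (|K| + 1) ≤ c := div_le_self hc.le (by linarith [abs_nonneg K])
  refine ⟨c / (|K| + 1), by positivity, hcK.trans hc1, m, fun s hs hsc => ?_⟩
  have hsm : s ^ m ≤ 1 := pow_le_one₀ hs.le (by linarith)
  have hne : ∀ t, 0 < t → t < c / (|K| + 1) * s ^ m → q.evalEval s t ≠ 0 := by
    intro t ht htc h0
    have ht1 : t ≤ 1 := by nlinarith [show 0 < c / (|K| + 1) by positivity]
    have hb := hK (s, t) ⟨⟨hs.le, by linarith⟩, ⟨ht.le, ht1⟩⟩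
    simp only [Real.norm_eq_abs] at hb
    have hrt : r.evalEval s t = 0 := by
      rw [hr, Polynomial.evalEval_mul, Polynomial.evalEval_pow, Polynomial.evalEval_X] at h0
      rcases mul_eq_zero.mp h0 with h | h
      · exact absurd h (pow_ne_zero _ ht.ne')
      · exact h
    rw [← Polynomial.X_mul_divX_add r] at hrt
    simp only [Polynomial.evalEval_add, Polynomial.evalEval_mul, Polynomial.evalEval_X,
      Polynomial.evalEval_C] at hrt
    have hl := hlow s hs (hsc.trans_le hcK)
    rw [show (r.coeff 0).eval s = -(t * r.divX.evalEval s t) by linarith, abs_neg, abs_mul,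
      abs_of_pos ht] at hl
    have h1 : t * |r.divX.evalEval s t| ≤ t * (|K| + 1) :=
      mul_le_mul_of_nonneg_left (by linarith [le_abs_self K]) ht.le
    have h2 : t * (|K| + 1) < c * s ^ m := by
      calc t * (|K| + 1) < (c / (|K| + 1) * s ^ m) * (|K| + 1) := mul_lt_mul_of_pos_right htc hK0
        _ = c * s ^ m := by field_simp
    linarith
  have main : ∀ t t', 0 < t → t < c / (|K| + 1) * s ^ m → 0 < t' → t' < c / (|K| + 1) * s ^ m →
      0 < q.evalEval s t → 0 < q.evalEval s t' := by
    intro t t' h1 h2 h3 h4 h5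
    have e : ∀ z, (q.map (Polynomial.evalRingHom s)).eval z = q.evalEval s z := fun z => by
      rw [Polynomial.map_evalRingHom_eval]
    rw [← e] at h5 ⊢
    refine pos_of_no_root ?_ h5
    intro z hz
    rw [e]
    have : Set.uIcc t t' ⊆ Set.Ioo 0 (c / (|K| + 1) * s ^ m) :=
      Set.OrdConnected.uIcc_subset Set.ordConnected_Ioo ⟨h1, h2⟩ ⟨h3, h4⟩
    exact hne z (this hz).1 (this hz).2
  exact fun t t' h1 h2 h3 h4 => ⟨main t t' h1 h2 h3 h4, main t' t h3 h4 h1 h2⟩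

/-- the point with scalar coordinates `s`, `t` and everything else zero -/
def pt {β : Type*} (s t : ℝ) : Bool ⊕ β → ℝ := Sum.elim (fun b => if b then t else s) 0

lemma exists_two {β : Type*} (p : MvPolynomial (Bool ⊕ β) ℝ) : ∃ q : ℝ[X][X], ∀ s t,
    q.evalEval s t = MvPolynomial.eval (pt s t) p := by
  induction p using MvPolynomial.induction_on with
  | C a => exact ⟨Polynomial.C (Polynomial.C a), fun s t => by simp⟩
  | add p q hp hq =>
    obtain ⟨P, hP⟩ := hp
    obtain ⟨Q, hQ⟩ := hq
    exact ⟨P + Q, fun s t => by simp [hP, hQ]⟩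
  | mul_X p j hp =>
    obtain ⟨P, hP⟩ := hp
    rcases j with (b | b)
    · cases b
      · exact ⟨P * Polynomial.C Polynomial.X, fun s t => by
          rw [Polynomial.evalEval_mul, Polynomial.evalEval_C, hP]; simp [pt]⟩
      · exact ⟨P * Polynomial.X, fun s t => by simp [hP, pt]⟩
    · exact ⟨0, fun s t => by simp [pt]⟩

lemma two_var_set {β : Type*} {F : Set (MvPolynomial (Bool ⊕ β) ℝ)} (hF : F.Finite) :
    ∃ c : ℝ, 0 < c ∧ c ≤ 1 ∧ ∃ m : ℕ, ∀ s, 0 < s → s < c →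
    ∀ t t', 0 < t → t < c * s ^ m → 0 < t' → t' < c * s ^ m → ∀ p ∈ F,
      (0 < MvPolynomial.eval (pt s t) p ↔ 0 < MvPolynomial.eval (pt s t') p) := by
  induction F, hF using Set.Finite.induction_on with
  | empty => exact ⟨1, one_pos, le_rfl, 0, by simp⟩
  | @insert p F _ _ ih =>
    obtain ⟨c, hc, hc1, m, h⟩ := ih
    obtain ⟨q, hq⟩ := exists_two p
    obtain ⟨c', hc', hc1', m', h'⟩ := two_var q
    refine ⟨min c c', lt_min hc hc', (min_le_left _ _).trans hc1, max m m', ?_⟩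
    intro s hs hsc t t' h1 h2 h3 h4
    have hs1 : s ≤ 1 := (hsc.trans_le ((min_le_left _ _).trans hc1)).le
    have e1 : min c c' * s ^ (max m m') ≤ c * s ^ m :=
      mul_le_mul (min_le_left _ _) (pow_le_pow_of_le_one hs.le hs1 (le_max_left _ _))
        (by positivity) hc.le
    have e2 : min c c' * s ^ (max m m') ≤ c' * s ^ m' :=
      mul_le_mul (min_le_right _ _) (pow_le_pow_of_le_one hs.le hs1 (le_max_right _ _))
        (by positivity) hc'.le
    rintro p' (rfl | hp')
    · rw [← hq, ← hq]
      exact h' s hs (hsc.trans_le (min_le_right _ _)) t t' h1 (h2.trans_le e2) h3 (h4.trans_le e2)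
    · exact h s hs (hsc.trans_le (min_le_left _ _)) t t' h1 (h2.trans_le e1) h3 (h4.trans_le e1)
        p' hp'

lemma SA.two {β : Type*} {E : (Bool ⊕ β → ℝ) → Prop} (hE : SA E) :
    ∃ c : ℝ, 0 < c ∧ c ≤ 1 ∧ ∃ m : ℕ, ∀ s, 0 < s → s < c →
    ∀ t t', 0 < t → t < c * s ^ m → 0 < t' → t' < c * s ^ m →
      (E (pt s t) ↔ E (pt s t')) := by
  obtain ⟨F, hF, hdet⟩ := hE.determined
  obtain ⟨c, hc, hc1, m, h⟩ := two_var_set hF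
  exact ⟨c, hc, hc1, m, fun s h1 h2 t t' h3 h4 h5 h6 => hdet _ _ (h s h1 h2 t t' h3 h4 h5 h6)⟩

end twovar

section final

/-- index type: two scalars and two blocks of `n` variables -/
abbrev Ix (n : ℕ) := Bool ⊕ (Bool × Fin n)

def blk (n : ℕ) (b : Bool) : Finset (Ix n) := Finset.univ.image fun i => Sum.inr (b, i)

lemma SA.exblk {n : ℕ} {E : (Ix n → ℝ) → Prop} (h : SA E) (b : Bool) :
    SA fun v : Ix n → ℝ => ∃ y : Fin n → ℝ, E (fun j : Ix n => match j with
      | Sum.inl c => v (Sum.inl c)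
      | Sum.inr (c, i) => if c = b then y i else v (Sum.inr (c, i))) := by
  refine (congrArg SA ?_).mp (h.exs (blk n b))
  funext v; apply propext
  constructor
  · rintro ⟨w, hw⟩
    refine ⟨fun i => w (.inr (b, i)), ?_⟩
    convert hw using 1
    funext j
    rcases j with (c | ⟨c, i⟩)
    · simp [Finset.piecewise, blk]
    · by_cases hc : c = b
      · subst hc; simp [Finset.piecewise, blk]
      · simp [Finset.piecewise, blk, hc, Ne.symm hc]
  · rintro ⟨y, hy⟩
    refine ⟨fun j => match j with
      | .inl c => 0
      | .inr (c, i) => y i, ?_⟩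
    convert hy using 1
    funext j
    rcases j with (c | ⟨c, i⟩)
    · simp [Finset.piecewise, blk]
    · by_cases hc : c = b
      · subst hc; simp [Finset.piecewise, blk]
      · simp [Finset.piecewise, blk, hc, Ne.symm hc]

/-- squared distance of the blocks -/
noncomputable def dsq (n : ℕ) : MvPolynomial (Ix n) ℝ :=
  ∑ i : Fin n, (MvPolynomial.X (.inr (false, i)) - MvPolynomial.X (.inr (true, i))) ^ 2

/-- The bad set in the parameters `s, t` is semialgebraic. -/
lemma bad_SA {n k : ℕ} (f : Fin k → Finset (MvPolynomial (Fin n) ℝ)) :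
    ∃ E : (Ix n → ℝ) → Prop, SA E ∧ ∀ s t, E (pt s t) ↔ ∃ x : Fin n → ℝ,
      (∀ j, ∃ y : Fin n → ℝ, (∀ Q ∈ f j, MvPolynomial.eval y Q = 0) ∧
        ∑ i, (x i - y i) ^ 2 < t ^ 2) ∧
      (∀ z : Fin n → ℝ, (∀ j, ∀ Q ∈ f j, MvPolynomial.eval z Q = 0) →
        s ^ 2 ≤ ∑ i, (x i - z i) ^ 2) := by
  have hmem : ∀ j, SA fun v : Ix n → ℝ => ∀ Q ∈ (↑(f j) : Set (MvPolynomial (Fin n) ℝ)),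
      MvPolynomial.eval (fun i => v (.inr (true, i))) Q = 0 := by
    intro j
    apply isBA_SA.all (Finset.finite_toSet _)
    intro Q _
    have := SA.eq (MvPolynomial.rename (fun i : Fin n => (.inr (true, i) : Ix n)) Q) 0
    simpa [MvPolynomial.eval_rename, Function.comp_def] using this
  have h1 : ∀ j, SA fun v : Ix n → ℝ => ∃ y : Fin n → ℝ, (∀ Q ∈ f j, MvPolynomial.eval y Q = 0) ∧
      ∑ i, (v (.inr (false, i)) - y i) ^ 2 < v (.inl true) ^ 2 := by
    intro j
    have := ((hmem j).and (SA.lt (dsq n) (MvPolynomial.X (.inl true) ^ 2))).exblk true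
    simpa [dsq] using this
  have h2 : SA fun v : Ix n → ℝ => ∃ y : Fin n → ℝ, (∀ j, ∀ Q ∈ f j, MvPolynomial.eval y Q = 0) ∧
      ∑ i, (v (.inr (false, i)) - y i) ^ 2 < v (.inl false) ^ 2 := by
    have := ((isBA_SA.all (Set.finite_univ (α := Fin k)) (fun j _ => hmem j)).and
      (SA.lt (dsq n) (MvPolynomial.X (.inl false) ^ 2))).exblk true
    simpa [dsq] using this
  have h3 := ((isBA_SA.all (Set.finite_univ (α := Fin k)) (fun j _ => h1 j)).and h2.not).exblk false
  refine ⟨_, h3, fun s t => ?_⟩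
  simp [pt]

lemma exists_t {n k : ℕ} (S : Fin k → Set (EuclideanSpace ℝ (Fin n))) (hcl : ∀ j, IsClosed (S j))
    (hsep : SeparatedAtInfinity S) (hk : 0 < k) {s : ℝ} (hs : 0 < s) :
    ∃ t > 0, ∀ x : EuclideanSpace ℝ (Fin n), (∀ j, infDist x (S j) < t) →
      infDist x (⋂ j, S j) < s := by
  by_contra hcon
  push Not at hcon
  obtain ⟨⟨o, ho⟩, hsep⟩ := hsep
  have hne : ∀ j, (S j).Nonempty := fun j => ⟨o, Set.mem_iInter.mp ho j⟩
  choose x hx hxs using fun l : ℕ => hcon (1 / ((l : ℝ) + 1)) (by positivity)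
  have hlim : Tendsto (fun l : ℕ => 1 / ((l : ℝ) + 1)) atTop (nhds 0) :=
    tendsto_one_div_add_atTop_nhds_zero_nat
  by_cases hb : Tendsto (fun l => ‖x l‖) atTop atTop
  · choose a ha hda using fun j l => (Metric.infDist_lt_iff (hne j)).mp (hx l j)
    have hd0 : ∀ j, Tendsto (fun l => dist (x l) (a j l)) atTop (nhds 0) := fun j =>
      squeeze_zero (fun _ => dist_nonneg) (fun l => (hda j l).le) hlim
    have hfin := hsep a ha (by
      intro j
      refine tendsto_atTop_mono (f := fun l => ‖x l‖ - 1) (fun l => ?_)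
        (tendsto_atTop_add_const_right _ (-1) hb)
      have h1 := hda j l
      have h2 : 1 / ((l : ℝ) + 1) ≤ 1 := by
        rw [div_le_one (by positivity)]; linarith [(Nat.cast_nonneg l : (0:ℝ) ≤ l)]
      rw [dist_eq_norm] at h1
      have := norm_sub_norm_le (x l) (a j l)
      linarith) (by
      intro j m _
      have := (hd0 j).add (hd0 m)
      rw [add_zero] at this
      refine squeeze_zero (fun _ => norm_nonneg _) (fun l => ?_) this
      rw [← dist_eq_norm, dist_comm (x l) (a j l)]
      exact dist_triangle _ _ _) ⟨0, hk⟩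
    have := (hd0 ⟨0, hk⟩).add hfin
    rw [add_zero] at this
    obtain ⟨l, hl⟩ := (this.eventually (gt_mem_nhds hs)).exists
    have h1 := Metric.infDist_le_infDist_add_dist (s := ⋂ i, S i) (x := x l) (y := a ⟨0, hk⟩ l)
    linarith [hxs l]
  · rw [Filter.tendsto_atTop] at hb
    push Not at hb
    obtain ⟨R, hR⟩ := hb
    have hfr : ∃ᶠ l in atTop, x l ∈ Metric.closedBall (0 : EuclideanSpace ℝ (Fin n)) R := by
      refine hR.mono fun l hl => ?_
      simp only [mem_closedBall, dist_zero_right]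
      linarith
    obtain ⟨y, -, φ, hφ, hy⟩ := (isCompact_closedBall (0 : EuclideanSpace ℝ (Fin n)) R).tendsto_subseq' hfr
    have hyS : y ∈ ⋂ j, S j := by
      rw [Set.mem_iInter]
      intro j
      rw [(hcl j).mem_iff_infDist_zero (hne j)]
      have h1 : Tendsto (fun l => infDist (x (φ l)) (S j)) atTop (nhds (infDist y (S j))) :=
        ((continuous_infDist_pt (S j)).tendsto y).comp hy
      have h2 : Tendsto (fun l => infDist (x (φ l)) (S j)) atTop (nhds 0) :=
        squeeze_zero (fun _ => infDist_nonneg) (fun l => (hx (φ l) j).le)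
          (hlim.comp hφ.tendsto_atTop)
      exact tendsto_nhds_unique h1 h2
    have h1 : Tendsto (fun l => infDist (x (φ l)) (⋂ j, S j)) atTop (nhds (infDist y (⋂ j, S j))) :=
      ((continuous_infDist_pt _).tendsto y).comp hy
    rw [infDist_zero_of_mem hyS] at h1
    obtain ⟨l, hl⟩ := (h1.eventually (gt_mem_nhds hs)).exists
    linarith [hxs (φ l)]

end final
end SAProof

/-- **Proposition 3.2.** If `S_1, …, S_k ⊆ ℝ^n` are real algebraic sets which are
separated at infinity, and `S = S_1 ∩ ⋯ ∩ S_k`, then there are positive constants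
`θ, C, δ` with `C d(x,S)^θ ≤ d(x,S_1) + ⋯ + d(x,S_k)` whenever
`max_j d(x,S_j) < δ`. -/
theorem statement6 (n k : ℕ) (S : Fin k → Set (EuclideanSpace ℝ (Fin n)))
    (halg : ∀ j, ∃ s : Finset (MvPolynomial (Fin n) ℝ),
      S j = {x : EuclideanSpace ℝ (Fin n) | ∀ Q ∈ s, eval (fun i => x i) Q = 0})
    (hsep : SeparatedAtInfinity S) :
    ∃ θ : ℝ, 0 < θ ∧ ∃ C : ℝ, 0 < C ∧ ∃ δ : ℝ, 0 < δ ∧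
      ∀ x : EuclideanSpace ℝ (Fin n), (∀ j, infDist x (S j) < δ) →
        C * infDist x (⋂ j, S j) ^ θ ≤ ∑ j, infDist x (S j) := by
  rcases Nat.eq_zero_or_pos k with rfl | hk
  · refine ⟨1, one_pos, 1, one_pos, 1, one_pos, fun x _ => ?_⟩
    simp [infDist_zero_of_mem]
  choose f hf using halg
  have hcl : ∀ j, IsClosed (S j) := by
    intro j
    rw [hf j]
    simp only [Set.ofPred_forall]
    refine isClosed_iInter fun Q => isClosed_iInter fun _ => ?_
    refine isClosed_eq ?_ continuous_const
    exact (MvPolynomial.continuous_eval Q).comp (by fun_prop)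
  have hne : (⋂ j, S j).Nonempty := hsep.1
  have hnej : ∀ j, (S j).Nonempty := fun j => hne.mono (Set.iInter_subset _ j)
  have hdist : ∀ x y : EuclideanSpace ℝ (Fin n), ∑ i, (x i - y i) ^ 2 = dist x y ^ 2 := by
    intro x y
    rw [EuclideanSpace.dist_eq, Real.sq_sqrt (Finset.sum_nonneg fun i _ => sq_nonneg _)]
    simp [Real.dist_eq]
  obtain ⟨E, hE, hEiff⟩ := SAProof.bad_SA f
  -- reformulation of the bad predicate
  have hbad : ∀ s t, 0 < s → 0 < t → (E (SAProof.pt s t) ↔ ∃ x : EuclideanSpace ℝ (Fin n),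
      (∀ j, infDist x (S j) < t) ∧ s ≤ infDist x (⋂ j, S j)) := by
    intro s t hs ht
    rw [hEiff]
    constructor
    · rintro ⟨x, h1, h2⟩
      refine ⟨WithLp.toLp 2 x, fun j => ?_, ?_⟩
      · obtain ⟨y, hy, hxy⟩ := h1 j
        rw [infDist_lt_iff (hnej j)]
        refine ⟨WithLp.toLp 2 y, by rw [hf j]; exact hy, ?_⟩
        have := hdist (WithLp.toLp 2 x) (WithLp.toLp 2 y)
        simp only at this
        rw [this] at hxy
        exact lt_of_pow_lt_pow_left₀ 2 ht.le hxy
      · rw [le_infDist hne]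
        intro z hz
        have := h2 (fun i => z i) (fun j => by
          have := Set.mem_iInter.mp hz j
          rw [hf j] at this
          exact this)
        have h3 := hdist (WithLp.toLp 2 x) z
        simp only at h3
        rw [h3] at this
        exact le_of_sq_le_sq this dist_nonneg
    · rintro ⟨x, h1, h2⟩
      refine ⟨fun i => x i, fun j => ?_, fun z hz => ?_⟩
      · obtain ⟨y, hy, hxy⟩ := (infDist_lt_iff (hnej j)).mp (h1 j)
        refine ⟨fun i => y i, by rw [hf j] at hy; exact hy, ?_⟩
        rw [hdist]
        exact pow_lt_pow_left₀ hxy dist_nonneg two_ne_zero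
      · have := (le_infDist hne).mp h2 (y := WithLp.toLp 2 z) (by
          rw [Set.mem_iInter]
          intro j
          rw [hf j]
          exact hz j)
        have h3 := hdist x (WithLp.toLp 2 z)
        simp only at h3
        rw [h3]
        exact pow_le_pow_left₀ hs.le this 2
  obtain ⟨c, hc, hc1, m, hcm⟩ := hE.two
  obtain ⟨δ, hδ, hδs⟩ := SAProof.exists_t S hcl hsep hk hc
  refine ⟨(m + 1 : ℕ), by positivity, c / 2, by positivity, δ, hδ, fun x hx => ?_⟩
  rw [Real.rpow_natCast]
  have hsc := hδs x hx
  have hsum : ∀ j, infDist x (S j) ≤ ∑ j, infDist x (S j) := fun j =>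
    Finset.single_le_sum (f := fun j => infDist x (S j)) (fun _ _ => infDist_nonneg)
      (Finset.mem_univ j)
  rcases (infDist_nonneg : 0 ≤ infDist x (⋂ j, S j)).eq_or_lt with h0 | hs
  · rw [← h0]
    simpa using Finset.sum_nonneg fun j _ => infDist_nonneg
  set s := infDist x (⋂ j, S j) with hsdef
  have hsm : s ^ (m + 1) ≤ s ^ m := pow_le_pow_of_le_one hs.le (by linarith) (by omega)
  by_contra hlt
  push Not at hlt
  have hpos : 0 < c * s ^ m := by positivity
  obtain ⟨t, ht, htt⟩ := SAProof.exists_t S hcl hsep hk hs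
  have hB : E (SAProof.pt s (c / 2 * s ^ m)) := by
    rw [hbad s _ hs (by positivity)]
    refine ⟨x, fun j => ?_, le_rfl⟩
    have : c / 2 * s ^ (m + 1) ≤ c / 2 * s ^ m := mul_le_mul_of_nonneg_left hsm (by positivity)
    exact ((hsum j).trans_lt hlt).trans_le this
  have ht' : 0 < min t (c / 2 * s ^ m) := by positivity
  rw [hcm s hs hsc _ (min t (c / 2 * s ^ m)) (by positivity) (by linarith) ht'
    ((min_le_right _ _).trans_lt (by linarith)), hbad s _ hs ht'] at hB
  obtain ⟨x', h1, h2⟩ := hB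
  have := htt x' fun j => (h1 j).trans_le (min_le_left _ _)
  linarith
end
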